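/- arXiv:1610.06610 — 7 statements merged into one kernel-verified Lean document; each statement's English description precedes it below -/
import Mathlib

section
/- Let n ≥ 1 and suppose (d_1,…,d_n) is a regular degree sequence for ℂ[x_1,…,x_n]. Then for every i = 1,…,n, the number β_i := #{1 ≤ j ≤ n : i divides d_j} satisfies β_i ≥ ⌊n/i⌋. In particular, n! divides the product d_1·d_2⋯d_n. -/
open MvPolynomial

/-- A sequence of polynomials is a regular sequence if each element is a
nonzerodivisor modulo the ideal generated by the previous ones. -/
def RegSeq {n : ℕ} (fs : List (MvPolynomial (Fin n) ℂ)) : Prop :=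
  ∀ i : Fin fs.length, ∀ g : MvPolynomial (Fin n) ℂ,
    g * fs.get i ∈ Ideal.span {p | p ∈ fs.take i.1} →
    g ∈ Ideal.span {p | p ∈ fs.take i.1}

/-- `(d 1, …, d n)` is a regular degree sequence if there is a regular sequence of
homogeneous symmetric polynomials of these degrees in `ℂ[x_1,…,x_n]`. -/
def IsRegularDegreeSequence (n : ℕ) (d : Fin n → ℕ) : Prop :=
  ∃ f : Fin n → MvPolynomial (Fin n) ℂ,
    (∀ i, (f i).IsHomogeneous (d i) ∧ (f i).IsSymmetric) ∧
    RegSeq ((List.finRange n).map f)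

open Finset in
theorem Nat.factorial_dvd_prod_of_div_le_card {n : ℕ} {ι : Type*} [Fintype ι] (d : ι → ℕ)
    (hd : ∀ j, 0 < d j) (h : ∀ i, 1 ≤ i → i ≤ n → n / i ≤ #{j | i ∣ d j}) :
    n.factorial ∣ ∏ j, d j := by
  have hprod : ∏ j, d j ≠ 0 := prod_ne_zero_iff.mpr fun j _ => (hd j).ne'
  rw [← Nat.factorization_prime_le_iff_dvd n.factorial_ne_zero hprod]
  intro p hp
  set b := n + (∑ j, d j) + 1 with hb
  have hlt : ∀ m, m < b → m < p ^ b := fun m hm => hm.trans (Nat.lt_pow_self hp.one_lt)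
  have hdb : ∀ j, d j < b := fun j => by
    have := single_le_sum (f := d) (fun _ _ => Nat.zero_le _) (mem_univ j)
    lia
  rw [Nat.factorization_factorial hp (b := b) ((Nat.log_le_self p n).trans_lt (by lia)),
    Nat.factorization_prod fun j _ => (hd j).ne', Finsupp.finsetSum_apply]
  calc ∑ i ∈ Ico 1 b, n / p ^ i ≤ ∑ i ∈ Ico 1 b, #{j | p ^ i ∣ d j} := by
        refine sum_le_sum fun i _ => ?_
        rcases le_or_gt (p ^ i) n with hle | hgt
        · exact h _ (Nat.one_le_pow _ _ hp.pos) hle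
        · simp [Nat.div_eq_of_lt hgt]
    _ = ∑ j, #{i ∈ Ico 1 b | p ^ i ∣ d j} := by
        simp_rw [card_filter]
        exact sum_comm
    _ = ∑ j, (d j).factorization p := by
        refine sum_congr rfl fun j _ => ?_
        rw [Nat.factorization_eq_card_pow_dvd_of_lt hp (hd j) (hlt _ (hdb j))]

/-- A prime ideal containing the first `j` terms of a (weakly) regular sequence has height at
least `j`. -/
theorem Ideal.le_height_of_regular {R : Type*} [CommRing R] (fs : List R)
    (h : ∀ i : Fin fs.length, ∀ g : R, g * fs.get i ∈ Ideal.span {p | p ∈ fs.take i.1} →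
      g ∈ Ideal.span {p | p ∈ fs.take i.1})
    (j : ℕ) (hj : j ≤ fs.length) (P : Ideal R) [P.IsPrime]
    (hP : Ideal.span {p | p ∈ fs.take j} ≤ P) : (j : ℕ∞) ≤ P.height := by
  induction j generalizing P with
  | zero => simp
  | succ j ih =>
    have hmono : Ideal.span {p | p ∈ fs.take j} ≤ P :=
      (Ideal.span_mono fun _ hp => (List.take_subset_take_left fs j.le_succ) hp).trans hP
    obtain ⟨Q, hQ, hQP⟩ := Ideal.exists_minimalPrimes_le hmono
    have := hQ.isPrime
    have hfP : fs.get ⟨j, hj⟩ ∈ P :=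
      hP (Ideal.subset_span (List.mem_take_iff_getElem.mpr ⟨j, by lia, rfl⟩))
    have hfQ : fs.get ⟨j, hj⟩ ∉ Q := fun hf => by
      obtain ⟨y, hy, hxy⟩ := Ideal.exists_mul_mem_of_mem_minimalPrimes hQ hf
      exact hy (h ⟨j, hj⟩ y (by rwa [mul_comm]))
    have hlt : Q < P := lt_of_le_of_ne hQP fun he => hfQ (he ▸ hfP)
    calc ((j + 1 : ℕ) : ℕ∞) = j + 1 := by push_cast; rfl
      _ ≤ Q.height + 1 := by gcongr; exact ih (by lia) Q hQ.le
      _ ≤ P.height := Ideal.height_add_one_le_of_lt_of_isPrime hlt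

namespace MvPolynomial

theorem sub_aeval_mem_of_forall {σ R : Type*} [CommRing R] (v : σ → MvPolynomial σ R)
    (I : Ideal (MvPolynomial σ R)) (hI : ∀ l, X l - v l ∈ I) (f : MvPolynomial σ R) :
    f - aeval v f ∈ I := by
  rw [← Ideal.Quotient.mk_eq_mk_iff_sub_mem]
  have : Ideal.Quotient.mkₐ R I = (Ideal.Quotient.mkₐ R I).comp (aeval v) := by
    ext l
    simpa using Ideal.Quotient.mk_eq_mk_iff_sub_mem _ _ |>.mpr (hI l)
  exact DFunLike.congr_fun this f

protected theorem IsHomogeneous.aeval_smul {σ R A : Type*} [CommSemiring R] [CommSemiring A] [Algebra R A]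
    {f : MvPolynomial σ R} {d : ℕ} (hf : f.IsHomogeneous d) (c : R) (v : σ → A) :
    MvPolynomial.aeval (c • v) f = c ^ d • MvPolynomial.aeval v f := by
  simp only [aeval_def, eval₂_eq, Finset.smul_sum]
  refine Finset.sum_congr rfl fun m hm => ?_
  have hdeg : ∑ i ∈ m.support, m i = d := by
    rw [← hf (mem_support_iff.mp hm)]
    simp [Finsupp.weight_apply, Finsupp.sum]
  simp only [Pi.smul_apply, smul_pow, Finset.prod_smul]
  rw [Finset.prod_pow_eq_pow_sum, hdeg, mul_smul_comm]

/-- A symmetric form of degree `d` vanishes at a point that some permutation of the coordinates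
scales by `c`, unless `c ^ d = 1`. -/
theorem IsSymmetric.aeval_eq_zero {σ K A : Type*} [Field K] [CommRing A] [Algebra K A]
    {f : MvPolynomial σ K} {d : ℕ} (hsymm : f.IsSymmetric) (hf : f.IsHomogeneous d)
    (π : Equiv.Perm σ) (c : K) (hc : c ^ d ≠ 1) (v : σ → A) (hv : ∀ l, v (π l) = c • v l) :
    aeval v f = 0 := by
  have h1 : aeval v f = c ^ d • aeval v f := by
    rw [← hf.aeval_smul c v]
    conv_lhs => rw [← hsymm π, aeval_rename]
    rw [show v ∘ π = c • v from _root_.funext hv]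
  have h2 : (c ^ d - 1) • aeval v f = 0 := by rw [sub_smul, one_smul, ← h1, sub_self]
  have h3 := congrArg ((c ^ d - 1)⁻¹ • ·) h2
  simpa [smul_smul, inv_mul_cancel₀ (sub_ne_zero.mpr hc)] using h3

end MvPolynomial

open Finset in
theorem IsRegularDegreeSequence.div_le_card {n : ℕ} {d : Fin n → ℕ} (hd : ∀ j, 0 < d j)
    (hreg : IsRegularDegreeSequence n d) (i : ℕ) (hi : 1 ≤ i) : n / i ≤ #{j | i ∣ d j} := by
  classical
  obtain ⟨f, hf, hfreg⟩ := hreg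
  obtain ⟨m, rfl⟩ : ∃ m, i = m + 1 := ⟨i - 1, by lia⟩
  set k := n / (m + 1)
  obtain ⟨ζ, hζ⟩ : ∃ ζ : ℂ, IsPrimitiveRoot ζ (m + 1) :=
    ⟨_, Complex.isPrimitiveRoot_exp (m + 1) m.succ_ne_zero⟩
  let e : (Fin k × Fin (m + 1)) ⊕ Fin (n % (m + 1)) ≃ Fin n :=
    Fintype.equivOfCardEq (by simpa using Nat.div_add_mod' n (m + 1))
  let π : Equiv.Perm (Fin n) := e.permCongr
    (Equiv.sumCongr (Equiv.prodCongr (Equiv.refl _) (Equiv.addRight 1)) (Equiv.refl _))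
  let w : (Fin k × Fin (m + 1)) ⊕ Fin (n % (m + 1)) → MvPolynomial (Fin n) ℂ :=
    Sum.elim (fun q => ζ ^ (q.2 : ℕ) • X (e (Sum.inl (q.1, 0)))) 0
  let v : Fin n → MvPolynomial (Fin n) ℂ := w ∘ e.symm
  have hv : ∀ l, v (π l) = ζ • v l := by
    intro l
    obtain ⟨s, rfl⟩ := e.surjective l
    rcases s with ⟨q, a⟩ | s
    · have : ζ ^ ((a + 1 : Fin (m + 1)) : ℕ) = ζ * ζ ^ (a : ℕ) := by
        rw [← pow_succ', Fin.val_add, ← pow_mod_orderOf _ ((a : ℕ) + 1), ← hζ.eq_orderOf]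
        simp
      simp [v, π, w, Equiv.permCongr_apply, this, smul_smul]
    · simp [v, π, w, Equiv.permCongr_apply]
  let reps : Finset (Fin n) := univ.image fun q : Fin k => e (Sum.inl (q, 0))
  have hreps : #reps = k := by
    rw [card_image_of_injective _ fun a b hab => by simpa using hab]
    simp
  have hvreps : ∀ l ∈ reps, X l - v l = 0 := by
    intro l hl
    obtain ⟨q, -, rfl⟩ := mem_image.mp hl
    simp [v, w]
  let T : Finset (MvPolynomial (Fin n) ℂ) :=
    ({j | (m + 1) ∣ d j} : Finset (Fin n)).image f ∪ repsᶜ.image fun l => X l - v l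
  let J : Ideal (MvPolynomial (Fin n) ℂ) := Ideal.span T
  have hXJ : ∀ l, X l - v l ∈ J := by
    intro l
    by_cases hl : l ∈ reps
    · simp [hvreps l hl]
    · refine Ideal.subset_span (mem_coe.mpr (mem_union_right _ ?_))
      exact mem_image_of_mem _ (mem_compl.mpr hl)
  have hfJ : ∀ j, f j ∈ J := by
    intro j
    by_cases hj : (m + 1) ∣ d j
    · refine Ideal.subset_span (mem_coe.mpr (mem_union_left _ ?_))
      exact mem_image_of_mem _ (by simpa using hj)
    · have h0 := (hf j).2.aeval_eq_zero (hf j).1 π ζ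
        (fun h => hj ((hζ.pow_eq_one_iff_dvd _).mp h)) v hv
      have hsub := sub_aeval_mem_of_forall v J hXJ (f j)
      rwa [h0, sub_zero] at hsub
  have hheight : (n : ℕ∞) ≤ J.height := by
    rw [Ideal.height_eq_inf_minimalPrimes]
    refine le_iInf₂ fun P hP => ?_
    have := hP.isPrime
    refine Ideal.le_height_of_regular _ hfreg n (by simp) P (le_trans ?_ hP.le)
    rw [Ideal.span_le]
    intro p hp
    obtain ⟨j, -, rfl⟩ := List.mem_map.mp (List.mem_of_mem_take hp)
    exact hfJ j
  have hJ : J ≠ ⊤ := by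
    refine ne_top_of_le_ne_top (RingHom.ker_ne_top (constantCoeff (σ := Fin n) (R := ℂ))) ?_
    rw [Ideal.span_le]
    intro p hp
    rcases mem_union.mp (mem_coe.mp hp) with hp | hp
    · obtain ⟨j, -, rfl⟩ := mem_image.mp hp
      exact (hf j).1.coeff_eq_zero (by simpa using (hd j).ne)
    · obtain ⟨l, -, rfl⟩ := mem_image.mp hp
      obtain ⟨s, rfl⟩ := e.surjective l
      rcases s with s | s <;> simp [v, w, smul_eq_C_mul, RingHom.mem_ker]
  have hT : n ≤ #T := by
    have h1 := hheight.trans (J.height_le_spanFinrank hJ)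
    have h2 := Submodule.spanFinrank_span_le_ncard_of_finite
      (R := MvPolynomial (Fin n) ℂ) T.finite_toSet
    rw [Set.ncard_coe_finset] at h2
    exact (by exact_mod_cast h1 : n ≤ _).trans h2
  have hTcard : #T ≤ #{j | (m + 1) ∣ d j} + (n - k) := by
    refine (card_union_le _ _).trans (add_le_add card_image_le (card_image_le.trans ?_))
    rw [card_compl, hreps, Fintype.card_fin]
  have hkn : k ≤ n := Nat.div_le_self _ _
  lia

theorem beta_condition (n : ℕ) (hn : 1 ≤ n) (d : Fin n → ℕ) (hd : ∀ j, 0 < d j)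
    (hreg : IsRegularDegreeSequence n d) :
    (∀ i, 1 ≤ i → i ≤ n →
      n / i ≤ (Finset.univ.filter fun j => i ∣ d j).card) ∧
    Nat.factorial n ∣ ∏ j, d j := by
  have h : ∀ i, 1 ≤ i → i ≤ n → n / i ≤ (Finset.univ.filter fun j => i ∣ d j).card :=
    fun i hi _ => hreg.div_le_card hd i hi
  exact ⟨h, Nat.factorial_dvd_prod_of_div_le_card d hd h⟩
end

section
/- For n = 2 and positive integers d_1, d_2, the following are equivalent: (i) (d_1,d_2) is a regular degree sequence for ℂ[x_1,x_2]; (ii) (d_1,d_2) is permissible; (iii) (d_1,d_2) satisfies condition (*), i.e., at least one of d_1, d_2 is even. -/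
open MvPolynomial

/-- Condition (*): for each `i = 1,…,n`, `#{j : i ∣ d j} ≥ ⌊n/i⌋`. -/
def CondStar (n : ℕ) (d : Fin n → ℕ) : Prop :=
  ∀ i, 1 ≤ i → i ≤ n → n / i ≤ (Finset.univ.filter fun j => i ∣ d j).card

/-- Condition (†): for each `i = 1,…,n`, `#{j : d j ≤ i} ≤ i`. -/
def CondDagger (n : ℕ) (d : Fin n → ℕ) : Prop :=
  ∀ i, 1 ≤ i → i ≤ n → (Finset.univ.filter fun j => d j ≤ i).card ≤ i

/-- A degree sequence is permissible if it satisfies (*) and (†). -/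
def Permissible (n : ℕ) (d : Fin n → ℕ) : Prop :=
  CondStar n d ∧ CondDagger n d

theorem MvPolynomial.IsHomogeneous.aeval_mul_left {σ R A : Type*} [CommSemiring R]
    [CommSemiring A] [Algebra R A] {f : MvPolynomial σ R} {m : ℕ} (hf : f.IsHomogeneous m)
    (c : A) (g : σ → A) :
    MvPolynomial.aeval (fun i => c * g i) f = c ^ m * MvPolynomial.aeval g f := by
  simp only [aeval_def, eval₂_eq, Finset.mul_sum]
  refine Finset.sum_congr rfl fun s hs => ?_
  have hs : s.degree = m := by
    by_contra h
    exact mem_support_iff.1 hs (hf.coeff_eq_zero h)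
  rw [← hs, Finsupp.degree_apply, ← Finset.prod_pow_eq_pow_sum]
  simp only [mul_pow, Finset.prod_mul_distrib]
  ring

theorem MvPolynomial.IsSymmetric.aeval_eq_zero_of_odd {K A : Type*} [Field K] [CharZero K]
    [CommRing A] [Algebra K A] {f : MvPolynomial (Fin 2) K} {m : ℕ} (hs : f.IsSymmetric)
    (hf : f.IsHomogeneous m) (hm : Odd m) {g : Fin 2 → A} (hg : g 0 + g 1 = 0) :
    MvPolynomial.aeval g f = 0 := by
  have hswap : g ∘ Equiv.swap 0 1 = fun i => -1 * g i := by
    funext i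
    fin_cases i
    · simpa using eq_neg_of_add_eq_zero_right hg
    · simpa using eq_neg_of_add_eq_zero_left hg
  have key : aeval g f = -aeval g f := by
    conv_lhs => rw [← hs (Equiv.swap 0 1)]
    rw [aeval_rename, hswap, hf.aeval_mul_left, hm.neg_one_pow, neg_one_mul]
  have htwo : (2 : K) • aeval g f = 0 := by
    rw [two_smul]
    exact eq_neg_iff_add_eq_zero.1 key
  exact (smul_eq_zero_iff_right two_ne_zero).1 htwo

theorem MvPolynomial.IsSymmetric.X_zero_add_X_one_dvd_of_odd {K : Type*} [Field K] [CharZero K]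
    {f : MvPolynomial (Fin 2) K} {m : ℕ}
    (hs : f.IsSymmetric) (hf : f.IsHomogeneous m) (hm : Odd m) :
    MvPolynomial.X 0 + MvPolynomial.X 1 ∣ f := by
  rw [← Ideal.mem_span_singleton, ← Ideal.Quotient.eq_zero_iff_mem]
  set I : Ideal (MvPolynomial (Fin 2) K) := Ideal.span {X 0 + X 1}
  have hsum : Ideal.Quotient.mkₐ K I (X 0) + Ideal.Quotient.mkₐ K I (X 1) = 0 := by
    rw [← map_add]
    exact Ideal.Quotient.eq_zero_iff_mem.2 (Ideal.mem_span_singleton_self _)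
  have hmk := aeval_unique (Ideal.Quotient.mkₐ K I)
  change Ideal.Quotient.mkₐ K I f = 0
  rw [hmk]
  exact hs.aeval_eq_zero_of_odd hf hm hsum

theorem regSeq_pair_iff {n : ℕ} (p q : MvPolynomial (Fin n) ℂ) :
    RegSeq [p, q] ↔ p ≠ 0 ∧ ∀ g, p ∣ g * q → p ∣ g := by
  have hsing : {x | x ∈ [p]} = {p} := by ext; simp
  constructor
  · intro h
    constructor
    · rintro rfl
      have := h ⟨0, by simp⟩ 1
      simp at this
    · intro g hg
      have := h ⟨1, by simp⟩ g
      simp only [List.take_succ_cons, List.take_zero, hsing, Ideal.mem_span_singleton] at this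
      exact this hg
  · rintro ⟨hp, h⟩ ⟨i, hi⟩ g hg
    have hi : i < 2 := hi
    interval_cases i
    · simpa [hp] using hg
    · simp only [List.take_succ_cons, List.take_zero, hsing, Ideal.mem_span_singleton] at hg ⊢
      exact h g hg

theorem isRegularDegreeSequence_two_iff (d : Fin 2 → ℕ) :
    IsRegularDegreeSequence 2 d ↔ ∃ p q : MvPolynomial (Fin 2) ℂ,
      (p.IsHomogeneous (d 0) ∧ p.IsSymmetric) ∧ (q.IsHomogeneous (d 1) ∧ q.IsSymmetric) ∧
      p ≠ 0 ∧ ∀ g, p ∣ g * q → p ∣ g := by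
  constructor
  · rintro ⟨f, hf, hreg⟩
    exact ⟨f 0, f 1, hf 0, hf 1, (regSeq_pair_iff _ _).1 hreg⟩
  · rintro ⟨p, q, hp, hq, hreg⟩
    exact ⟨![p, q], Fin.forall_fin_two.2 ⟨hp, hq⟩, (regSeq_pair_iff _ _).2 hreg⟩

theorem IsRegularDegreeSequence.even_or_even {d : Fin 2 → ℕ} (h : IsRegularDegreeSequence 2 d) :
    Even (d 0) ∨ Even (d 1) := by
  obtain ⟨p, q, ⟨hp, hps⟩, ⟨hq, hqs⟩, hp0, hreg⟩ := (isRegularDegreeSequence_two_iff d).1 h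
  by_contra! hodd
  simp only [Nat.not_even_iff_odd] at hodd
  obtain ⟨a, rfl⟩ := hps.X_zero_add_X_one_dvd_of_odd hp hodd.1
  obtain ⟨b, rfl⟩ := hqs.X_zero_add_X_one_dvd_of_odd hq hodd.2
  have ha : a ≠ 0 := right_ne_zero_of_mul hp0
  obtain ⟨c, hc⟩ := hreg a ⟨b, by ring⟩
  have hunit : (X 0 + X 1) * c = 1 := mul_left_cancel₀ ha (by linear_combination -hc)
  simpa using congrArg (eval 0) hunit

theorem isRelPrime_X_mul_X_pow_X_pow_add_X_pow {m : ℕ} (hm : 0 < m) (k : ℕ) :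
    IsRelPrime ((X 0 * X 1) ^ k : MvPolynomial (Fin 2) ℂ) (X 0 ^ m + X 1 ^ m) := by
  refine IsRelPrime.pow_left (IsRelPrime.mul_left ?_ ?_)
  · rw [X_prime.irreducible.isRelPrime_iff_not_dvd]
    rintro ⟨c, hc⟩
    simpa [hm.ne'] using congrArg (eval ![0, 1]) hc
  · rw [X_prime.irreducible.isRelPrime_iff_not_dvd]
    rintro ⟨c, hc⟩
    simpa [hm.ne'] using congrArg (eval ![1, 0]) hc

theorem isRegularDegreeSequence_two_of_even {d : Fin 2 → ℕ} (hd : ∀ j, 0 < d j)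
    (h : Even (d 0) ∨ Even (d 1)) : IsRegularDegreeSequence 2 d := by
  have hprod (k : ℕ) : ((X 0 * X 1) ^ k : MvPolynomial (Fin 2) ℂ).IsHomogeneous (k + k) ∧
      ((X 0 * X 1) ^ k : MvPolynomial (Fin 2) ℂ).IsSymmetric := by
    constructor
    · convert! ((isHomogeneous_X ℂ (0 : Fin 2)).mul (isHomogeneous_X ℂ 1)).pow k using 1
      ring
    · intro e
      have := Equiv.prod_comp e (X : Fin 2 → MvPolynomial (Fin 2) ℂ)
      simp only [Fin.prod_univ_two] at this
      simp [this]
  have hsum (m : ℕ) : (X 0 ^ m + X 1 ^ m : MvPolynomial (Fin 2) ℂ).IsHomogeneous m ∧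
      (X 0 ^ m + X 1 ^ m : MvPolynomial (Fin 2) ℂ).IsSymmetric := by
    constructor
    · exact (isHomogeneous_X_pow 0 m).add (isHomogeneous_X_pow 1 m)
    · simpa [psum] using psum_isSymmetric (Fin 2) ℂ m
  rw [isRegularDegreeSequence_two_iff]
  rcases h with ⟨k, hk⟩ | ⟨k, hk⟩
  · refine ⟨_, _, hk ▸ hprod k, hsum (d 1), pow_ne_zero _ (mul_ne_zero (X_ne_zero _) (X_ne_zero _)),
      fun g hg => ?_⟩
    exact (isRelPrime_X_mul_X_pow_X_pow_add_X_pow (hd 1) k).dvd_of_dvd_mul_right hg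
  · refine ⟨_, _, hsum (d 0), hk ▸ hprod k, fun h0 => ?_, fun g hg => ?_⟩
    · simpa [(hd 0).ne'] using congrArg (eval ![0, 1]) h0
    · exact (isRelPrime_X_mul_X_pow_X_pow_add_X_pow (hd 0) k).symm.dvd_of_dvd_mul_right hg

theorem condStar_two_iff (d : Fin 2 → ℕ) : CondStar 2 d ↔ (2 ∣ d 0 ∨ 2 ∣ d 1) := by
  constructor
  · intro h
    obtain ⟨j, hj⟩ := Finset.card_pos.1 (h 2 (by norm_num) le_rfl)
    have hj := (Finset.mem_filter.1 hj).2
    fin_cases j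
    · exact .inl hj
    · exact .inr hj
  · intro h i hi hi2
    interval_cases i
    · simp
    · refine Finset.card_pos.2 ?_
      rcases h with h | h
      · exact ⟨0, by simpa using h⟩
      · exact ⟨1, by simpa using h⟩

theorem CondStar.condDagger_two {d : Fin 2 → ℕ} (hd : ∀ j, 0 < d j) (h : CondStar 2 d) :
    CondDagger 2 d := by
  intro i hi hi2
  interval_cases i
  · obtain ⟨j, hj⟩ : ∃ j, 2 ∣ d j := Fin.exists_fin_two.2 ((condStar_two_iff d).1 h)
    refine Nat.le_of_lt_succ (Finset.card_lt_univ_of_notMem (x := j) ?_)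
    have := Nat.le_of_dvd (hd j) hj
    simp
    omega
  · exact Finset.card_le_univ _

theorem n_eq_two (d : Fin 2 → ℕ) (hd : ∀ j, 0 < d j) :
    (IsRegularDegreeSequence 2 d ↔ Permissible 2 d) ∧
    (Permissible 2 d ↔ CondStar 2 d) ∧
    (CondStar 2 d ↔ (2 ∣ d 0 ∨ 2 ∣ d 1)) := by
  have hperm : Permissible 2 d ↔ CondStar 2 d := ⟨And.left, fun h => ⟨h, h.condDagger_two hd⟩⟩
  refine ⟨?_, hperm, condStar_two_iff d⟩
  rw [hperm, condStar_two_iff, ← even_iff_two_dvd, ← even_iff_two_dvd]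
  exact ⟨IsRegularDegreeSequence.even_or_even, isRegularDegreeSequence_two_of_even hd⟩
end

section
/- For n = 3, a sequence (d_1,d_2,d_3) of positive integers is a regular degree sequence for ℂ[x_1,x_2,x_3] if and only if it is permissible. -/
open MvPolynomial

section NonZeroDivisorModulo

variable {R : Type*} [CommRing R]

/-- `f` is a nonzerodivisor modulo the ideal `J`. -/
def NZDMod (J : Ideal R) (f : R) : Prop :=
  ∀ g, g * f ∈ J → g ∈ J

lemma NZDMod.mul {J : Ideal R} {f f' : R} (h : NZDMod J f) (h' : NZDMod J f') :
    NZDMod J (f * f') :=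
  fun g hg => h g (h' _ (by rwa [mul_assoc]))

lemma NZDMod.congr {J : Ideal R} {f f' : R} (h : NZDMod J f) (hf : f' - f ∈ J) :
    NZDMod J f' := fun g hg => h g <| by
  have := J.sub_mem hg (J.mul_mem_left g hf)
  rwa [mul_sub, sub_sub_cancel] at this

/-- If `b` and `c` are successively nonzerodivisors modulo `J`, then `b` is a nonzerodivisor
modulo `J + (c)`. -/
lemma NZDMod.sup_of_sup {J : Ideal R} {b c : R} (hb : NZDMod J b)
    (hc : NZDMod (J ⊔ Ideal.span {b}) c) : NZDMod (J ⊔ Ideal.span {c}) b := by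
  intro g hg
  obtain ⟨j, hj, y, hy, hjy⟩ := Submodule.mem_sup.1 hg
  obtain ⟨h, rfl⟩ := Ideal.mem_span_singleton'.1 hy
  have h1 : h * c ∈ J ⊔ Ideal.span {b} := by
    have : h * c = -j + g * b := by rw [← hjy]; ring
    rw [this]
    exact Submodule.add_mem_sup (J.neg_mem hj)
      (Ideal.mul_mem_left _ _ (Ideal.mem_span_singleton_self b))
  obtain ⟨j', hj', z, hz, hjz⟩ := Submodule.mem_sup.1 (hc h h1)
  obtain ⟨h', rfl⟩ := Ideal.mem_span_singleton'.1 hz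
  have h2 : (g - h' * c) * b ∈ J := by
    have : (g - h' * c) * b = j + c * j' := by
      have e : g * b = j + h * c := hjy.symm
      rw [sub_mul, e, ← hjz]; ring
    rw [this]
    exact J.add_mem hj (J.mul_mem_left _ hj')
  have : g = (g - h' * c) + h' * c := by ring
  rw [this]
  exact Submodule.add_mem_sup (hb _ h2) (Ideal.mul_mem_left _ _ (Ideal.mem_span_singleton_self c))

/-- A prime containing an ideal together with a nonzerodivisor modulo that ideal contains a
strictly smaller prime containing the ideal. -/
lemma NZDMod.exists_isPrime_lt {J P : Ideal R} [P.IsPrime] {f : R} (hf : NZDMod J f)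
    (hJ : J ≤ P) (hfP : f ∈ P) : ∃ Q : Ideal R, Q.IsPrime ∧ J ≤ Q ∧ Q < P := by
  obtain ⟨Q, hQ, hQP⟩ := Ideal.exists_minimalPrimes_le hJ
  refine ⟨Q, hQ.1.1, hQ.1.2, lt_of_le_of_ne hQP ?_⟩
  rintro rfl
  obtain ⟨y, hy, h⟩ := Ideal.exists_mul_mem_of_mem_minimalPrimes hQ hfP
  exact hy (hf y (by rwa [mul_comm]))

end NonZeroDivisorModulo

section Graded

variable {σ K : Type*} [CommRing K]

lemma homogeneousComponent_mul_eq_zero {p : MvPolynomial σ K} {N d : ℕ} (hp : p.IsHomogeneous N)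
    (h : d < N) (r : MvPolynomial σ K) : homogeneousComponent d (p * r) = 0 := by
  conv_lhs => rw [← sum_homogeneousComponent r, Finset.mul_sum, map_sum]
  refine Finset.sum_eq_zero fun i _ => ?_
  rw [homogeneousComponent_of_mem (hp.mul (homogeneousComponent_isHomogeneous i r)),
    if_neg (by omega)]

lemma homogeneousComponent_mem_span {s : Set (MvPolynomial σ K)}
    (hs : ∀ p ∈ s, ∃ n, p.IsHomogeneous n) {g : MvPolynomial σ K} (hg : g ∈ Ideal.span s) (d : ℕ) :
    homogeneousComponent d g ∈ Ideal.span s := by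
  let := gradedAlgebra (σ := σ) (R := K)
  exact homogeneousComponent_mem_of_mem
    (Ideal.homogeneous_span (homogeneousSubmodule σ K) s hs) hg d

/-- Graded Nakayama argument: if `b` is homogeneous of positive degree and `b`, `c` are successively
nonzerodivisors modulo a homogeneous ideal, then `c` is a nonzerodivisor modulo that ideal. -/
lemma NZDMod.of_sup_span {s : Set (MvPolynomial σ K)} (hs : ∀ p ∈ s, ∃ n, p.IsHomogeneous n)
    {b c : MvPolynomial σ K} {e : ℕ} (he : 0 < e) (hbe : b.IsHomogeneous e)
    (hb : NZDMod (Ideal.span s) b) (hc : NZDMod (Ideal.span s ⊔ Ideal.span {b}) c) :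
    NZDMod (Ideal.span s) c := by
  set J := Ideal.span s
  have step : ∀ g, g * c ∈ J → ∃ g', g' * c ∈ J ∧ g - b * g' ∈ J := by
    intro g hg
    obtain ⟨j, hj, y, hy, rfl⟩ := Submodule.mem_sup.1 (hc g (Ideal.mem_sup_left hg))
    obtain ⟨g', rfl⟩ := Ideal.mem_span_singleton'.1 hy
    refine ⟨g', hb _ ?_, by ring_nf; exact hj⟩
    have := J.sub_mem hg (J.mul_mem_right c hj)
    ring_nf at this ⊢
    exact this
  have key : ∀ n g, g * c ∈ J → ∃ r, g - b ^ n * r ∈ J := by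
    intro n
    induction n with
    | zero => exact fun g _ => ⟨g, by simp⟩
    | succ n ih =>
      intro g hg
      obtain ⟨g', hg', h⟩ := step g hg
      obtain ⟨r, hr⟩ := ih g' hg'
      refine ⟨r, ?_⟩
      have := J.add_mem h (J.mul_mem_left b hr)
      ring_nf at this ⊢
      exact this
  intro g hg
  rw [← sum_homogeneousComponent g]
  refine J.sum_mem fun d _ => ?_
  obtain ⟨r, hr⟩ := key (d + 1) g hg
  have := homogeneousComponent_mem_span hs hr d
  rwa [map_sub, homogeneousComponent_mul_eq_zero (hbe.pow (d + 1)) (by nlinarith), sub_zero] at this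

/-- A regular sequence of length three of homogeneous polynomials of positive degree. -/
structure HomogReg (a b c : MvPolynomial σ K) : Prop where
  homog : (∃ n, 0 < n ∧ a.IsHomogeneous n) ∧ (∃ n, 0 < n ∧ b.IsHomogeneous n) ∧
    ∃ n, 0 < n ∧ c.IsHomogeneous n
  fst : NZDMod ⊥ a
  snd : NZDMod (Ideal.span {a}) b
  trd : NZDMod (Ideal.span {a, b}) c

namespace HomogReg

variable {a b c c' : MvPolynomial σ K}

lemma swap₁₂ (h : HomogReg a b c) : HomogReg b a c := by
  obtain ⟨⟨⟨n, hn, ha⟩, hb, hc⟩, h1, h2, h3⟩ := h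
  have e : (⊥ : Ideal (MvPolynomial σ K)) = Ideal.span ∅ := Ideal.span_empty.symm
  refine ⟨⟨hb, ⟨n, hn, ha⟩, hc⟩, ?_, ?_, by rwa [Set.pair_comm]⟩
  · rw [e] at h1 ⊢
    exact NZDMod.of_sup_span (by simp) hn ha h1 (by simpa using h2)
  · simpa using NZDMod.sup_of_sup h1 (by simpa using h2)

lemma swap₂₃ (h : HomogReg a b c) : HomogReg a c b := by
  obtain ⟨⟨⟨m, hm, ha⟩, ⟨n, hn, hb⟩, hc⟩, h1, h2, h3⟩ := h
  rw [Ideal.span_insert] at h3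
  refine ⟨⟨⟨m, hm, ha⟩, hc, ⟨n, hn, hb⟩⟩, h1, ?_, ?_⟩
  · exact NZDMod.of_sup_span (by simpa using ⟨m, ha⟩) hn hb h2 h3
  · rw [Ideal.span_insert]
    exact NZDMod.sup_of_sup h2 h3

lemma mul (h : HomogReg a b c) (h' : HomogReg a b c') : HomogReg a b (c * c') := by
  obtain ⟨m, hm, hc⟩ := h.homog.2.2
  obtain ⟨n, hn, hc'⟩ := h'.homog.2.2
  exact ⟨⟨h.homog.1, h.homog.2.1, m + n, by omega, hc.mul hc'⟩, h.fst, h.snd, h.trd.mul h'.trd⟩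

lemma pow (h : HomogReg a b c) {n : ℕ} (hn : n ≠ 0) : HomogReg a b (c ^ n) := by
  induction n with
  | zero => exact absurd rfl hn
  | succ n ih =>
    rcases eq_or_ne n 0 with rfl | h0
    · simpa using h
    · rw [pow_succ]; exact (ih h0).mul h

lemma pow_mul_pow (h : HomogReg a b c) (h' : HomogReg a b c') {m n : ℕ} (hmn : m ≠ 0 ∨ n ≠ 0) :
    HomogReg a b (c ^ m * c' ^ n) := by
  rcases eq_or_ne m 0 with rfl | hm
  · simpa using h'.pow (by simpa using hmn)
  rcases eq_or_ne n 0 with rfl | hn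
  · simpa using h.pow hm
  exact (h.pow hm).mul (h'.pow hn)

lemma congr (h : HomogReg a b c) {n : ℕ} (hn : 0 < n) (hc : c'.IsHomogeneous n)
    (hcc : ∃ u v, c' - c = u * a + v * b) : HomogReg a b c' :=
  ⟨⟨h.homog.1, h.homog.2.1, n, hn, hc⟩, h.fst, h.snd,
    h.trd.congr (Ideal.mem_span_pair.2 (by simpa only [eq_comm] using hcc))⟩

end HomogReg

end Graded

section Variables

variable {σ K : Type*} [CommRing K]

lemma nzdMod_span_X_image {s : Set σ} {i : σ} (hi : i ∉ s) :
    NZDMod (Ideal.span (X '' s : Set (MvPolynomial σ K))) (X i) := by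
  intro g hg
  rw [mem_ideal_span_X_image] at hg ⊢
  intro m hm
  obtain ⟨j, hj, h⟩ := hg (m + Finsupp.single i 1) (by simpa using hm)
  refine ⟨j, hj, ?_⟩
  have : i ≠ j := fun h => hi (h ▸ hj)
  simpa [Finsupp.single_apply, this] using h

lemma homogReg_X {i j k : σ} (hij : i ≠ j) (hik : i ≠ k) (hjk : j ≠ k) :
    HomogReg (X i : MvPolynomial σ K) (X j) (X k) where
  homog := ⟨⟨1, one_pos, isHomogeneous_X _ _⟩, ⟨1, one_pos, isHomogeneous_X _ _⟩,
    1, one_pos, isHomogeneous_X _ _⟩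
  fst := by simpa using nzdMod_span_X_image (K := K) (Set.notMem_empty i)
  snd := by simpa using nzdMod_span_X_image (K := K) (s := {i}) (i := j) (by simpa using hij.symm)
  trd := by
    simpa [Set.image_pair] using nzdMod_span_X_image (K := K) (s := {i, j}) (i := k)
      (by simp [hik.symm, hjk.symm])

end Variables

section Elementary

variable (K : Type*) [CommRing K]

lemma esymm_fin_three_one : esymm (Fin 3) K 1 = X 0 + X 1 + X 2 := by
  simp [esymm_one, Fin.sum_univ_three]

lemma esymm_fin_three_two : esymm (Fin 3) K 2 = X 0 * X 1 + X 0 * X 2 + X 1 * X 2 := by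
  have : Finset.powersetCard 2 (Finset.univ : Finset (Fin 3)) = {{0, 1}, {0, 2}, {1, 2}} := by
    decide
  rw [esymm, this, Finset.sum_insert (by decide), Finset.sum_insert (by decide),
    Finset.sum_singleton]
  simp [add_assoc]

lemma esymm_fin_three_three : esymm (Fin 3) K 3 = X 0 * X 1 * X 2 := by
  have : Finset.powersetCard 3 (Finset.univ : Finset (Fin 3)) = {Finset.univ} := by decide
  rw [esymm, this, Finset.sum_singleton, Fin.prod_univ_three]

lemma homogReg_esymm :
    HomogReg (esymm (Fin 3) K 1) (esymm (Fin 3) K 2) (esymm (Fin 3) K 3) := by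
  have hom₁ : (X 0 + X 1 + X 2 : MvPolynomial (Fin 3) K).IsHomogeneous 1 :=
    ((isHomogeneous_X _ _).add (isHomogeneous_X _ _)).add (isHomogeneous_X _ _)
  have hom₂ : (X 0 * X 1 + X 0 * X 2 + X 1 * X 2 : MvPolynomial (Fin 3) K).IsHomogeneous 2 :=
    (((isHomogeneous_X _ _).mul (isHomogeneous_X _ _)).add
      ((isHomogeneous_X _ _).mul (isHomogeneous_X _ _))).add
      ((isHomogeneous_X _ _).mul (isHomogeneous_X _ _))
  have key : ∀ i j k : Fin 3, i ≠ j → i ≠ k → j ≠ k →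
      (X 0 + X 1 + X 2 : MvPolynomial (Fin 3) K) = X i + X j + X k →
      (X 0 * X 1 + X 0 * X 2 + X 1 * X 2 : MvPolynomial (Fin 3) K) =
        X i * X j + X i * X k + X j * X k →
      HomogReg (X 0 + X 1 + X 2 : MvPolynomial (Fin 3) K)
        (X 0 * X 1 + X 0 * X 2 + X 1 * X 2) (X i) := by
    intro i j k hij hik hjk h₁ h₂
    have hj : HomogReg (X i) (X 0 + X 1 + X 2 : MvPolynomial (Fin 3) K) (X j) :=
      ((homogReg_X hij hik hjk).congr one_pos hom₁ ⟨1, 1, by rw [h₁]; ring⟩).swap₂₃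
    have hk : HomogReg (X i) (X 0 + X 1 + X 2 : MvPolynomial (Fin 3) K) (X k) :=
      ((homogReg_X hik hij hjk.symm).congr one_pos hom₁ ⟨1, 1, by rw [h₁]; ring⟩).swap₂₃
    exact ((hj.mul hk).congr two_pos hom₂ ⟨X j + X k, 0, by rw [h₂]; ring⟩).swap₁₂.swap₂₃
  rw [esymm_fin_three_one, esymm_fin_three_two, esymm_fin_three_three]
  exact ((key 0 1 2 (by decide) (by decide) (by decide) (by ring) (by ring)).mul
    (key 1 0 2 (by decide) (by decide) (by decide) (by ring) (by ring))).mul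
    (key 2 0 1 (by decide) (by decide) (by decide) (by ring) (by ring))

lemma homogReg_esymm_pow {i j k : ℕ} (hi : i ≠ 0) (hj : j ≠ 0) (hk : k ≠ 0) :
    HomogReg (esymm (Fin 3) K 1 ^ i) (esymm (Fin 3) K 2 ^ j) (esymm (Fin 3) K 3 ^ k) :=
  ((((homogReg_esymm K).pow hk).swap₂₃.pow hj).swap₂₃.swap₁₂.swap₂₃.pow hi).swap₂₃.swap₁₂

lemma esymm_fin_three_isHomogeneous (n : ℕ) : (esymm (Fin 3) K n).IsHomogeneous n := by
  rw [esymm]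
  refine IsHomogeneous.sum _ _ _ fun s hs => ?_
  simpa [(Finset.mem_powersetCard.1 hs).2] using
    IsHomogeneous.prod s (fun i => (X i : MvPolynomial (Fin 3) K)) (fun _ => 1)
      fun i _ => isHomogeneous_X _ _

lemma homogReg_esymm_pow_mul_pow_add {a i j m : ℕ} (ha : a ≠ 0) (hij : i ≠ 0 ∨ j ≠ 0)
    (hm : 0 < m) :
    HomogReg (esymm (Fin 3) K 1 ^ a) (esymm (Fin 3) K 2 ^ i * esymm (Fin 3) K 3 ^ j)
      (esymm (Fin 3) K 2 ^ (3 * m) + esymm (Fin 3) K 3 ^ (2 * m)) := by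
  set e₂ := esymm (Fin 3) K 2
  set e₃ := esymm (Fin 3) K 3
  have hom : (e₂ ^ (3 * m) + e₃ ^ (2 * m)).IsHomogeneous (6 * m) := by
    refine IsHomogeneous.add ?_ ?_
    · convert! (esymm_fin_three_isHomogeneous K 2).pow (3 * m) using 1; ring
    · convert! (esymm_fin_three_isHomogeneous K 3).pow (2 * m) using 1; ring
  have reg := homogReg_esymm_pow K ha one_ne_zero one_ne_zero
  rw [pow_one, pow_one] at reg
  have h₂ : HomogReg (esymm (Fin 3) K 1 ^ a) e₂ (e₂ ^ (3 * m) + e₃ ^ (2 * m)) :=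
    (reg.pow (n := 2 * m) (by omega)).congr (by omega) hom ⟨0, e₂ ^ (3 * m - 1), by
      rw [← pow_succ, show 3 * m - 1 + 1 = 3 * m by omega]; ring⟩
  have h₃ : HomogReg (esymm (Fin 3) K 1 ^ a) e₃ (e₂ ^ (3 * m) + e₃ ^ (2 * m)) :=
    (reg.swap₂₃.pow (n := 3 * m) (by omega)).congr (by omega) hom ⟨0, e₃ ^ (2 * m - 1), by
      rw [← pow_succ, show 2 * m - 1 + 1 = 2 * m by omega]; ring⟩
  exact (h₂.swap₂₃.pow_mul_pow h₃.swap₂₃ hij).swap₂₃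

end Elementary

section Vanishing

lemma aeval_mul_of_isHomogeneous {σ K S : Type*} [Fintype σ] [CommRing K] [CommRing S] [Algebra K S]
    {f : MvPolynomial σ K} {n : ℕ} (hf : f.IsHomogeneous n) (t : S) (p : σ → S) :
    aeval (fun i => t * p i) f = t ^ n * aeval p f := by
  rw [aeval_def, aeval_def, eval₂_eq', eval₂_eq', Finset.mul_sum]
  refine Finset.sum_congr rfl fun d hd => ?_
  have : ∑ i, d i = n := by
    rw [hf.degree_eq_sum_deg_support hd, ← Finsupp.degree_apply, Finsupp.degree_eq_sum]
  simp_rw [mul_pow, Finset.prod_mul_distrib, Finset.prod_pow_eq_pow_sum, this]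
  ring

/-- A symmetric homogeneous polynomial vanishes at a point whose coordinates are permuted by
scaling by `c`, unless `c ^ n = 1` where `n` is the degree. -/
lemma MvPolynomial.IsSymmetric.eval_eq_zero {σ K : Type*} [Fintype σ] [CommRing K] [IsDomain K]
    {f : MvPolynomial σ K} {n : ℕ} (hs : f.IsSymmetric) (hf : f.IsHomogeneous n)
    {e : Equiv.Perm σ} {p : σ → K} {c : K} (hp : ∀ i, p (e i) = c * p i) (hc : c ^ n ≠ 1) :
    eval p f = 0 := by
  have h : eval p f = c ^ n * eval p f := by
    conv_lhs => rw [← hs e, eval_rename]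
    have := aeval_mul_of_isHomogeneous hf c p
    rw [← _root_.funext hp] at this
    simpa [coe_aeval_eq_eval, Function.comp_def] using this
  have : (c ^ n - 1) * eval p f = 0 := by rw [sub_mul, ← h]; ring
  exact (mul_eq_zero.1 this).resolve_left (sub_ne_zero.2 hc)

/-- A homogeneous regular sequence of length three in three variables has no common zero other
than the origin. -/
lemma HomogReg.eq_zero_of_eval_eq_zero {K : Type*} [Field K] {a b c : MvPolynomial (Fin 3) K}
    (h : HomogReg a b c) {p : Fin 3 → K} (ha : eval p a = 0) (hb : eval p b = 0)
    (hc : eval p c = 0) : p = 0 := by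
  by_contra hp
  obtain ⟨i, hi⟩ := Function.ne_iff.1 hp
  let φ : MvPolynomial (Fin 3) K →ₐ[K] Polynomial K :=
    aeval fun i => Polynomial.X * Polynomial.C (p i)
  have hφ : ∀ f : MvPolynomial (Fin 3) K, (∃ n, 0 < n ∧ f.IsHomogeneous n) → eval p f = 0 →
      f ∈ RingHom.ker φ := by
    rintro f ⟨n, -, hf⟩ h0
    have hC : aeval (fun i => Polynomial.C (p i)) f = Polynomial.C (eval p f) := by
      rw [aeval_def, Polynomial.algebraMap_eq]
      exact (map_eval₂Hom (RingHom.id K) p Polynomial.C f).symm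
    rw [RingHom.mem_ker]
    change aeval _ f = 0
    rw [aeval_mul_of_isHomogeneous hf, hC, h0]
    simp
  let M := RingHom.ker (eval (0 : Fin 3 → K))
  have hlt : RingHom.ker φ < M := by
    refine lt_of_le_of_ne (fun f hf => ?_) fun heq => ?_
    · rw [RingHom.mem_ker] at hf ⊢
      have hcomp : ((Polynomial.aeval (0 : K)).comp φ) = aeval (0 : Fin 3 → K) := by
        ext i; simp [φ]
      have := DFunLike.congr_fun hcomp f
      rw [AlgHom.comp_apply, hf, map_zero] at this
      simpa [coe_aeval_eq_eval] using this.symm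
    · have : (X i : MvPolynomial (Fin 3) K) ∈ RingHom.ker φ := by
        rw [heq, RingHom.mem_ker]; simp
      rw [RingHom.mem_ker] at this
      exact hi (by simpa [φ] using this)
  have hP := RingHom.ker_isPrime φ
  have hM : M.IsPrime := RingHom.ker_isPrime _
  have hφa := hφ a h.homog.1 ha
  have hφb := hφ b h.homog.2.1 hb
  have hφc := hφ c h.homog.2.2 hc
  obtain ⟨Q₂, hQ₂, h₂, hlt₂⟩ := h.trd.exists_isPrime_lt
    (Ideal.span_le.2 (by simp [Set.insert_subset_iff, hφa, hφb])) hφc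
  have haQ : a ∈ Q₂ := h₂ (Ideal.subset_span (by simp))
  have hbQ : b ∈ Q₂ := h₂ (Ideal.subset_span (by simp))
  obtain ⟨Q₁, hQ₁, h₁, hlt₁⟩ := h.snd.exists_isPrime_lt (P := Q₂)
    (Ideal.span_le.2 (by simpa using haQ)) hbQ
  obtain ⟨Q₀, hQ₀, -, hlt₀⟩ := h.fst.exists_isPrime_lt (P := Q₁) bot_le
    (h₁ (Ideal.mem_span_singleton_self a))
  have hdim : (M.height : WithBot ℕ∞) ≤ 3 := by
    refine Ideal.height_le_ringKrullDim_of_isPrime.trans ?_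
    simp
  have e₁ := Ideal.height_add_one_le_of_lt_of_isPrime hlt₀
  have e₂ := Ideal.height_add_one_le_of_lt_of_isPrime hlt₁
  have e₃ := Ideal.height_add_one_le_of_lt_of_isPrime hlt₂
  have e₄ := Ideal.height_add_one_le_of_lt_of_isPrime hlt
  have h4 : (4 : ℕ∞) ≤ M.height := calc
    (4 : ℕ∞) = 0 + 1 + 1 + 1 + 1 := by norm_num
    _ ≤ Q₀.height + 1 + 1 + 1 + 1 := by gcongr; exact zero_le
    _ ≤ Q₁.height + 1 + 1 + 1 := by gcongr
    _ ≤ Q₂.height + 1 + 1 := by gcongr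
    _ ≤ (RingHom.ker φ).height + 1 := by gcongr
    _ ≤ M.height := e₄
  have h3 : M.height ≤ 3 := WithBot.coe_le_coe.1 hdim
  exact absurd (h4.trans h3) (by norm_num)

lemma MvPolynomial.IsSymmetric.eq_C_mul_of_isHomogeneous_one {σ K : Type*} [Fintype σ]
    [CommRing K] [Nonempty σ] {f : MvPolynomial σ K} (hs : f.IsSymmetric)
    (hf : f.IsHomogeneous 1) : ∃ s, f = MvPolynomial.C s * ∑ i, X i := by
  classical
  have hmem : f ∈ homogeneousSubmodule σ K 1 := hf
  rw [homogeneousSubmodule_one_eq_span_X, Submodule.mem_span_range_iff_exists_fun] at hmem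
  obtain ⟨c, rfl⟩ := hmem
  have hval : ∀ i, eval (Pi.single i 1) (∑ j, c j • X j : MvPolynomial σ K) = c i := by
    intro i
    simp [smul_eval, Pi.single_apply]
  obtain ⟨i⟩ := ‹Nonempty σ›
  refine ⟨c i, ?_⟩
  rw [Finset.mul_sum]
  refine Finset.sum_congr rfl fun j _ => ?_
  have : c j = c i := by
    rw [← hval j, ← hs (Equiv.swap i j), eval_rename, ← hval i]
    congr 2
    ext k
    simp only [Function.comp, Pi.single_apply]
    congr 1
    rw [Equiv.swap_apply_eq_iff, Equiv.swap_apply_right]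
  rw [this, smul_eq_C_mul]

lemma HomogReg.not_both_linear {σ K : Type*} [Fintype σ] [Nonempty σ] [Field K]
    {a b c : MvPolynomial σ K} (h : HomogReg a b c) (has : a.IsSymmetric) (hbs : b.IsSymmetric)
    (ha : a.IsHomogeneous 1) (hb : b.IsHomogeneous 1) : False := by
  obtain ⟨s, rfl⟩ := has.eq_C_mul_of_isHomogeneous_one ha
  obtain ⟨t, rfl⟩ := hbs.eq_C_mul_of_isHomogeneous_one hb
  rcases eq_or_ne s 0 with rfl | hs
  · simpa using h.fst 1 (by simp)
  · obtain ⟨r, hr⟩ := Ideal.mem_span_singleton'.1 (h.snd 1 (Ideal.mem_span_singleton'.2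
      ⟨C (t / s), by rw [← mul_assoc, ← C_mul, div_mul_cancel₀ t hs, one_mul]⟩))
    simpa using congrArg (eval 0) hr

end Vanishing

lemma regSeq_triple {n : ℕ} (a b c : MvPolynomial (Fin n) ℂ) :
    RegSeq [a, b, c] ↔
      NZDMod ⊥ a ∧ NZDMod (Ideal.span {a}) b ∧ NZDMod (Ideal.span {a, b}) c := by
  have e : {p | p = a ∨ p = b} = {a, b} := rfl
  simp [RegSeq, NZDMod, Fin.forall_fin_succ, e]

/-- There is a homogeneous regular sequence of symmetric polynomials of degrees `a`, `b`, `c`. -/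
def Realizable (a b c : ℕ) : Prop :=
  ∃ f g h : MvPolynomial (Fin 3) ℂ, (f.IsHomogeneous a ∧ f.IsSymmetric) ∧
    (g.IsHomogeneous b ∧ g.IsSymmetric) ∧ (h.IsHomogeneous c ∧ h.IsSymmetric) ∧ HomogReg f g h

namespace Realizable

variable {a b c : ℕ}

lemma swap₁₂ : Realizable a b c → Realizable b a c :=
  fun ⟨f, g, h, hf, hg, hh, r⟩ => ⟨g, f, h, hg, hf, hh, r.swap₁₂⟩

lemma swap₂₃ : Realizable a b c → Realizable a c b :=
  fun ⟨f, g, h, hf, hg, hh, r⟩ => ⟨f, h, g, hf, hh, hg, r.swap₂₃⟩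

lemma of_two_dvd_of_three_dvd (ha : 0 < a) (hb : 0 < b) (hc : 0 < c) (h2 : 2 ∣ b) (h3 : 3 ∣ c) :
    Realizable a b c := by
  obtain ⟨k, rfl⟩ := h2
  obtain ⟨l, rfl⟩ := h3
  have sym : ∀ n m, (esymm (Fin 3) ℂ n ^ m).IsSymmetric := fun n m =>
    (symmetricSubalgebra (Fin 3) ℂ).pow_mem (esymm_isSymmetric (Fin 3) ℂ n) m
  refine ⟨_, _, _, ⟨?_, sym 1 a⟩, ⟨?_, sym 2 k⟩, ⟨?_, sym 3 l⟩,
    homogReg_esymm_pow ℂ (by omega) (by omega) (by omega)⟩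
  · simpa using (esymm_fin_three_isHomogeneous ℂ 1).pow a
  · exact (esymm_fin_three_isHomogeneous ℂ 2).pow k
  · exact (esymm_fin_three_isHomogeneous ℂ 3).pow l

lemma of_six_dvd (ha : 0 < a) (hb : 1 < b) (hc : 0 < c) (h6 : 6 ∣ c) : Realizable a b c := by
  obtain ⟨m, rfl⟩ := h6
  obtain ⟨i, j, rfl⟩ : ∃ i j, b = 2 * i + 3 * j := by
    rcases Nat.even_or_odd' b with ⟨k, rfl | rfl⟩
    · exact ⟨k, 0, by omega⟩
    · exact ⟨k - 1, 1, by omega⟩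
  have sym : ∀ n m, (esymm (Fin 3) ℂ n ^ m).IsSymmetric := fun n m =>
    (symmetricSubalgebra (Fin 3) ℂ).pow_mem (esymm_isSymmetric (Fin 3) ℂ n) m
  have hom : ∀ n m, (esymm (Fin 3) ℂ n ^ m).IsHomogeneous (n * m) := fun n m =>
    (esymm_fin_three_isHomogeneous ℂ n).pow m
  refine ⟨_, _, _, ⟨by simpa using hom 1 a, sym 1 a⟩,
    ⟨(hom 2 i).mul (hom 3 j), (sym 2 i).mul (sym 3 j)⟩,
    ⟨?_, (sym 2 (3 * m)).add (sym 3 (2 * m))⟩,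
    homogReg_esymm_pow_mul_pow_add ℂ (by omega) (by omega) (by omega)⟩
  have h₂ := hom 2 (3 * m)
  have h₃ := hom 3 (2 * m)
  rw [← mul_assoc] at h₂ h₃
  exact h₂.add h₃

lemma two_dvd (h : Realizable a b c) : 2 ∣ a ∨ 2 ∣ b ∨ 2 ∣ c := by
  obtain ⟨f, g, h, ⟨hf, hfs⟩, ⟨hg, hgs⟩, ⟨hh, hhs⟩, r⟩ := h
  by_contra! hodd
  have hp : ∀ i, (![1, -1, 0] : Fin 3 → ℂ) (Equiv.swap 0 1 i) = -1 * ![1, -1, 0] i := by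
    intro i
    fin_cases i
    · simp
    · simp
    · simp [show Equiv.swap (0 : Fin 3) 1 2 = 2 by decide]
  have hc : ∀ n : ℕ, ¬ 2 ∣ n → (-1 : ℂ) ^ n ≠ 1 := by
    intro n hn
    rw [(Nat.not_even_iff_odd.1 (mt even_iff_two_dvd.1 hn)).neg_one_pow]
    norm_num
  have := congrFun (r.eq_zero_of_eval_eq_zero (hfs.eval_eq_zero hf hp (hc a hodd.1))
    (hgs.eval_eq_zero hg hp (hc b hodd.2.1)) (hhs.eval_eq_zero hh hp (hc c hodd.2.2))) 0
  simp at this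

lemma three_dvd (h : Realizable a b c) : 3 ∣ a ∨ 3 ∣ b ∨ 3 ∣ c := by
  obtain ⟨f, g, h, ⟨hf, hfs⟩, ⟨hg, hgs⟩, ⟨hh, hhs⟩, r⟩ := h
  by_contra! hnd
  obtain ⟨ω, hω⟩ : ∃ ω : ℂ, IsPrimitiveRoot ω 3 := ⟨_, Complex.isPrimitiveRoot_exp 3 (by norm_num)⟩
  have hp : ∀ i, (![1, ω, ω ^ 2] : Fin 3 → ℂ) (finRotate 3 i) = ω * ![1, ω, ω ^ 2] i := by
    intro i
    fin_cases i
    · simp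
    · simp [pow_two]
    · simp [← pow_succ', hω.pow_eq_one]
  have hc : ∀ n : ℕ, ¬ 3 ∣ n → ω ^ n ≠ 1 := fun n hn h => hn (hω.dvd_of_pow_eq_one n h)
  have := congrFun (r.eq_zero_of_eval_eq_zero (hfs.eval_eq_zero hf hp (hc a hnd.1))
    (hgs.eval_eq_zero hg hp (hc b hnd.2.1)) (hhs.eval_eq_zero hh hp (hc c hnd.2.2))) 0
  simp at this

lemma not_both_one (h : Realizable 1 1 c) : False :=
  let ⟨_, _, _, hf, hg, _, r⟩ := h
  r.not_both_linear hf.2 hg.2 hf.1 hg.1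

end Realizable

lemma realizable_iff {a b c : ℕ} (ha : 0 < a) (hb : 0 < b) (hc : 0 < c) :
    Realizable a b c ↔ (2 ∣ a ∨ 2 ∣ b ∨ 2 ∣ c) ∧ (3 ∣ a ∨ 3 ∣ b ∨ 3 ∣ c) ∧
      ¬ (a = 1 ∧ b = 1) ∧ ¬ (a = 1 ∧ c = 1) ∧ ¬ (b = 1 ∧ c = 1) := by
  constructor
  · refine fun h => ⟨h.two_dvd, h.three_dvd, ?_, ?_, ?_⟩
    · rintro ⟨rfl, rfl⟩
      exact h.not_both_one
    · rintro ⟨rfl, rfl⟩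
      exact h.swap₂₃.not_both_one
    · rintro ⟨rfl, rfl⟩
      exact h.swap₁₂.swap₂₃.not_both_one
  · have six : ∀ {x y z : ℕ}, 0 < x → 0 < y → 0 < z → ¬ (x = 1 ∧ y = 1) → 2 ∣ z → 3 ∣ z →
        Realizable x y z := by
      intro x y z hx hy hz hxy h2 h3
      have h6 : 6 ∣ z := by omega
      rcases eq_or_ne y 1 with rfl | h
      · exact (Realizable.of_six_dvd hy (by omega) hz h6).swap₁₂
      · exact Realizable.of_six_dvd hx (by omega) hz h6
    rintro ⟨h2 | h2 | h2, h3 | h3 | h3, hab, hac, hbc⟩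
    · exact (six hb hc ha hbc h2 h3).swap₂₃.swap₁₂
    · exact (Realizable.of_two_dvd_of_three_dvd hc ha hb h2 h3).swap₁₂.swap₂₃
    · exact (Realizable.of_two_dvd_of_three_dvd hb ha hc h2 h3).swap₁₂
    · exact (Realizable.of_two_dvd_of_three_dvd hc hb ha h2 h3).swap₂₃.swap₁₂.swap₂₃
    · exact (six ha hc hb hac h2 h3).swap₂₃
    · exact Realizable.of_two_dvd_of_three_dvd ha hb hc h2 h3
    · exact (Realizable.of_two_dvd_of_three_dvd hb hc ha h2 h3).swap₂₃.swap₁₂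
    · exact (Realizable.of_two_dvd_of_three_dvd ha hc hb h2 h3).swap₂₃
    · exact six ha hb hc hab h2 h3

lemma isRegularDegreeSequence_three_iff (d : Fin 3 → ℕ) (hd : ∀ j, 0 < d j) :
    IsRegularDegreeSequence 3 d ↔ Realizable (d 0) (d 1) (d 2) := by
  have hl : ∀ f : Fin 3 → MvPolynomial (Fin 3) ℂ, (List.finRange 3).map f = [f 0, f 1, f 2] :=
    fun _ => rfl
  constructor
  · rintro ⟨f, hf, hreg⟩
    rw [hl, regSeq_triple] at hreg
    exact ⟨f 0, f 1, f 2, hf 0, hf 1, hf 2, ⟨⟨_, hd 0, (hf 0).1⟩, ⟨_, hd 1, (hf 1).1⟩,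
      ⟨_, hd 2, (hf 2).1⟩⟩, hreg.1, hreg.2.1, hreg.2.2⟩
  · rintro ⟨f, g, h, hf, hg, hh, r⟩
    refine ⟨![f, g, h], fun i => ?_, ?_⟩
    · fin_cases i
      exacts [hf, hg, hh]
    · rw [hl]
      exact (regSeq_triple f g h).2 ⟨r.fst, r.snd, r.trd⟩

lemma permissible_three_iff (d : Fin 3 → ℕ) (hd : ∀ j, 0 < d j) :
    Permissible 3 d ↔ (2 ∣ d 0 ∨ 2 ∣ d 1 ∨ 2 ∣ d 2) ∧ (3 ∣ d 0 ∨ 3 ∣ d 1 ∨ 3 ∣ d 2) ∧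
      ¬ (d 0 = 1 ∧ d 1 = 1) ∧ ¬ (d 0 = 1 ∧ d 2 = 1) ∧ ¬ (d 1 = 1 ∧ d 2 = 1) := by
  have h0 := hd 0
  have h1 := hd 1
  have h2 := hd 2
  simp only [Permissible, CondStar, CondDagger, Finset.card_filter, Fin.sum_univ_three]
  constructor
  · rintro ⟨hs, ht⟩
    have s2 := hs 2 (by norm_num) (by norm_num)
    have s3 := hs 3 (by norm_num) (by norm_num)
    have t1 := ht 1 (by norm_num) (by norm_num)
    grind
  · rintro ⟨h2, h3, h⟩
    refine ⟨fun i hi hi3 => ?_, fun i hi hi3 => ?_⟩ <;> interval_cases i <;> grind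

theorem n_eq_three (d : Fin 3 → ℕ) (hd : ∀ j, 0 < d j) :
    IsRegularDegreeSequence 3 d ↔ Permissible 3 d := by
  rw [isRegularDegreeSequence_three_iff d hd, realizable_iff (hd 0) (hd 1) (hd 2),
    permissible_three_iff d hd]
end

section
/- For n = 4, a sequence (d_1,d_2,d_3,d_4) of positive integers is a regular degree sequence for ℂ[x_1,x_2,x_3,x_4] if and only if it is permissible and is not equal, as an unordered sequence (multiset), to (1,2,5,12δ), (2,2,5,12δ), or (5,2,5,12δ) for any positive integer δ. -/
open MvPolynomial

section Regularity

/-- The list, read from right to left, is a weakly regular sequence. -/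
def RevRegular {R : Type*} [CommRing R] : List R → Prop
  | [] => True
  | f :: l => RevRegular l ∧ ∀ g, g * f ∈ Ideal.ofList l → g ∈ Ideal.ofList l

theorem mem_ofList_cons {R : Type*} [CommRing R] {f g : R} {l : List R} :
    g ∈ Ideal.ofList (f :: l) ↔ ∃ h, g - h * f ∈ Ideal.ofList l := by
  rw [Ideal.ofList_cons, Ideal.mem_span_singleton_sup]
  constructor
  · rintro ⟨a, b, hb, rfl⟩
    exact ⟨a, by simpa using hb⟩
  · rintro ⟨h, hh⟩
    exact ⟨h, _, hh, by ring⟩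

theorem pow_mem_ofList {R : Type*} [CommRing R] {f : R} {l : List R} (hf : f ∈ l) {n : ℕ}
    (hn : 0 < n) : f ^ n ∈ Ideal.ofList l :=
  Ideal.pow_mem_of_mem _ (Ideal.subset_span (show f ∈ {r | r ∈ l} from hf)) n hn

theorem ofList_perm {R : Type*} [CommRing R] {l l' : List R} (h : l.Perm l') :
    Ideal.ofList l = Ideal.ofList l' := by
  simp only [Ideal.ofList, h.mem_iff]

variable {σ K : Type*} [CommRing K]

theorem homogeneousComponent_mem_ofList {l : List (MvPolynomial σ K)}
    (hl : ∀ f ∈ l, ∃ d, 0 < d ∧ f.IsHomogeneous d) {g : MvPolynomial σ K}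
    (hg : g ∈ Ideal.ofList l) (m : ℕ) : homogeneousComponent m g ∈ Ideal.ofList l := by
  let := gradedAlgebra (σ := σ) (R := K)
  have h : (Ideal.span {f | f ∈ l}).IsHomogeneous (homogeneousSubmodule σ K) :=
    Ideal.homogeneous_span _ _ fun f hf ↦ by
      obtain ⟨d, -, hd⟩ := hl f hf
      exact ⟨d, hd⟩
  exact homogeneousComponent_mem_of_mem h hg m

theorem homogeneousComponent_mul_eq_zero_s3 {b h : MvPolynomial σ K} {d m : ℕ}
    (hb : b.IsHomogeneous d) (hm : m < d) : homogeneousComponent m (h * b) = 0 := by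
  rw [← sum_homogeneousComponent h, Finset.sum_mul, map_sum]
  refine Finset.sum_eq_zero fun i _ ↦ ?_
  rw [homogeneousComponent_of_mem ((homogeneousComponent_isHomogeneous i h).mul hb),
    if_neg (by omega)]

theorem mem_of_forall_sub_mul_pow_mem {l : List (MvPolynomial σ K)}
    (hl : ∀ f ∈ l, ∃ d, 0 < d ∧ f.IsHomogeneous d) {b g : MvPolynomial σ K} {d : ℕ} (hd : 0 < d)
    (hb : b.IsHomogeneous d) (h : ∀ n, ∃ k, g - k * b ^ n ∈ Ideal.ofList l) :
    g ∈ Ideal.ofList l := by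
  rw [← sum_homogeneousComponent g]
  refine Ideal.sum_mem _ fun m _ ↦ ?_
  obtain ⟨k, hk⟩ := h (m + 1)
  have := homogeneousComponent_mem_ofList hl hk m
  rwa [map_sub, homogeneousComponent_mul_eq_zero_s3 (hb.pow (m + 1)) (by nlinarith), sub_zero] at this

theorem RevRegular.swap {a b : MvPolynomial σ K} {l : List (MvPolynomial σ K)}
    (hl : ∀ f ∈ b :: l, ∃ d, 0 < d ∧ f.IsHomogeneous d) (h : RevRegular (a :: b :: l)) :
    RevRegular (b :: a :: l) := by
  obtain ⟨⟨hr, hb⟩, ha⟩ := h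
  refine ⟨⟨hr, fun g hg ↦ ?_⟩, fun g hg ↦ ?_⟩
  · obtain ⟨d, hd, hbd⟩ := hl b (by simp)
    refine mem_of_forall_sub_mul_pow_mem (fun f hf ↦ hl f (by simp [hf])) hd hbd fun n ↦ ?_
    suffices ∃ k, g - k * b ^ n ∈ Ideal.ofList l ∧ k * a ∈ Ideal.ofList l from
      this.imp fun _ h ↦ h.1
    induction n with
    | zero => exact ⟨g, by simp, hg⟩
    | succ n ih =>
      obtain ⟨k, hk, hka⟩ := ih
      obtain ⟨k', hk'⟩ := mem_ofList_cons.1 <|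
        ha k (mem_ofList_cons.2 ⟨0, by simpa using hka⟩)
      refine ⟨k', ?_, hb _ ?_⟩
      · have := Ideal.add_mem _ hk (Ideal.mul_mem_left _ (b ^ n) hk')
        convert this using 1
        ring
      · have := Ideal.sub_mem _ hka (Ideal.mul_mem_left _ a hk')
        convert this using 1
        ring
  · obtain ⟨h, hh⟩ := mem_ofList_cons.1 hg
    obtain ⟨k, hk⟩ := mem_ofList_cons.1 <| ha h <| mem_ofList_cons.2 ⟨g, by
      rw [← neg_mem_iff]
      convert hh using 1
      ring⟩
    refine mem_ofList_cons.2 ⟨k, hb _ ?_⟩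
    have := Ideal.add_mem _ hh (Ideal.mul_mem_left _ a hk)
    convert this using 1
    ring

/-- A weakly regular sequence (read from right to left) of homogeneous polynomials of positive
degree. -/
def HomRegular (l : List (MvPolynomial σ K)) : Prop :=
  (∀ f ∈ l, ∃ d, 0 < d ∧ f.IsHomogeneous d) ∧ RevRegular l

namespace HomRegular

variable {f g : MvPolynomial σ K} {l l' : List (MvPolynomial σ K)}

theorem perm (h : HomRegular l) (hp : l.Perm l') : HomRegular l' := by
  refine ⟨fun f hf ↦ h.1 f (hp.mem_iff.2 hf), ?_⟩
  obtain ⟨hl, hr⟩ := h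
  induction hp with
  | nil => trivial
  | cons x hp ih =>
    exact ⟨ih (fun f hf ↦ hl f (by simp [hf])) hr.1, ofList_perm hp ▸ hr.2⟩
  | swap x y l =>
    exact hr.swap fun f hf ↦ hl f (by simp at hf ⊢; tauto)
  | trans h₁ h₂ ih₁ ih₂ => exact ih₂ (fun f hf ↦ hl f (h₁.mem_iff.2 hf)) (ih₁ hl hr)

theorem mul (hf : HomRegular (f :: l)) (hg : HomRegular (g :: l)) :
    HomRegular (f * g :: l) := by
  obtain ⟨d, hd, hfd⟩ := hf.1 f (by simp)
  obtain ⟨e, he, hge⟩ := hg.1 g (by simp)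
  refine ⟨?_, hf.2.1, fun h hh ↦ hf.2.2 _ (hg.2.2 _ (by rwa [mul_assoc]))⟩
  rintro p (_ | ⟨_, hp⟩)
  · exact ⟨d + e, by omega, hfd.mul hge⟩
  · exact hf.1 p (List.mem_cons_of_mem _ hp)

theorem pow (hf : HomRegular (f :: l)) {n : ℕ} (hn : 0 < n) : HomRegular (f ^ n :: l) := by
  induction n, hn using Nat.le_induction with
  | base => simpa using hf
  | succ n _ ih => exact pow_succ f n ▸ ih.mul hf

theorem pow_mul_pow (hf : HomRegular (f :: l)) (hg : HomRegular (g :: l)) {i j : ℕ}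
    (hij : 0 < i + j) : HomRegular (f ^ i * g ^ j :: l) := by
  rcases i.eq_zero_or_pos with rfl | hi
  · simpa using hg.pow (by omega : 0 < j)
  rcases j.eq_zero_or_pos with rfl | hj
  · simpa using hf.pow hi
  exact (hf.pow hi).mul (hg.pow hj)

theorem congr (hf : HomRegular (f :: l)) {d : ℕ} (hd : 0 < d) (hg : g.IsHomogeneous d)
    (hfg : g - f ∈ Ideal.ofList l) : HomRegular (g :: l) := by
  refine ⟨?_, hf.2.1, fun h hh ↦ hf.2.2 h ?_⟩
  · rintro p (_ | ⟨_, hp⟩)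
    · exact ⟨d, hd, hg⟩
    · exact hf.1 p (List.mem_cons_of_mem _ hp)
  · have := Ideal.sub_mem _ hh (Ideal.mul_mem_left _ h hfg)
    convert this using 1
    ring

theorem map_X {l : List σ} (hl : l.Nodup) :
    HomRegular (l.map (X : σ → MvPolynomial σ K)) := by
  refine ⟨?_, ?_⟩
  · simp only [List.mem_map]
    rintro _ ⟨i, -, rfl⟩
    exact ⟨1, one_pos, isHomogeneous_X _ _⟩
  · induction l with
    | nil => trivial
    | cons i l ih =>
      rw [List.nodup_cons] at hl
      refine ⟨ih hl.2, fun g hg ↦ ?_⟩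
      have : Ideal.ofList (l.map (X : σ → MvPolynomial σ K)) = Ideal.span (X '' {i | i ∈ l}) := by
        rw [Ideal.ofList]
        congr 1
        ext
        simp
      rw [this, mem_ideal_span_X_image] at hg ⊢
      intro m hm
      obtain ⟨j, hj, hj'⟩ := hg (m + Finsupp.single i 1) (by
        rw [mem_support_iff, coeff_mul_X]
        exact mem_support_iff.1 hm)
      refine ⟨j, hj, ?_⟩
      have hij : i ≠ j := by
        rintro rfl
        exact hl.1 hj
      simpa [Finsupp.single_apply, hij] using hj'

theorem swap {a b : MvPolynomial σ K} (h : HomRegular (a :: b :: l)) : HomRegular (b :: a :: l) :=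
  h.perm (.swap ..)

theorem third {a b c : MvPolynomial σ K} (h : HomRegular (a :: b :: c :: l)) :
    HomRegular (c :: a :: b :: l) :=
  h.perm (.trans (.cons _ (.swap ..)) (.swap ..))

theorem fourth {a b c e : MvPolynomial σ K} (h : HomRegular (a :: b :: c :: e :: l)) :
    HomRegular (e :: a :: b :: c :: l) :=
  h.perm (.trans (.cons _ (.trans (.cons _ (.swap ..)) (.swap ..))) (.swap ..))

theorem pow_mul_pow_cons_add_pow {c e : MvPolynomial σ K} {D : ℕ} (H : HomRegular (c :: e :: l))
    {i j m n : ℕ} (hij : 0 < i + j) (hm : 0 < m) (hn : 0 < n) (hD : 0 < D)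
    (hS : (c ^ m + e ^ n).IsHomogeneous D) :
    HomRegular ((c ^ i * e ^ j) :: (c ^ m + e ^ n) :: l) := by
  refine pow_mul_pow (swap ?_) (swap ?_) hij
  · refine (H.swap.pow hn).congr hD hS ?_
    simpa using pow_mem_ofList (l := c :: l) (by simp) hm
  · refine (H.pow hm).congr hD hS ?_
    simpa using pow_mem_ofList (l := e :: l) (by simp) hn

variable {a b c e : MvPolynomial σ K} {p q i j m n D E : ℕ}

theorem pows_of_pows (H : HomRegular [a, b, c, e]) (hp : 0 < p) (hq : 0 < q)
    (hm : 0 < m) (hn : 0 < n) : HomRegular [a ^ p, b ^ q, c ^ m, e ^ n] :=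
  ((((H.fourth.pow hn).fourth.pow hm).fourth.pow hq).fourth.pow hp)

theorem monomial_and_sum (H : HomRegular [a, b, c, e]) (hp : 0 < p) (hq : 0 < q)
    (hij : 0 < i + j) (hm : 0 < m) (hn : 0 < n) (hD : 0 < D)
    (hS : (c ^ m + e ^ n).IsHomogeneous D) :
    HomRegular [c ^ i * e ^ j, c ^ m + e ^ n, a ^ p, b ^ q] := by
  have := (H.pows_of_pows hp hq one_pos one_pos).fourth.fourth
  rw [pow_one, pow_one] at this
  exact this.pow_mul_pow_cons_add_pow hij hm hn hD hS

theorem product_and_two_sums (H : HomRegular [a, b, c, e]) (hp : 0 < p) (hq : 0 < q)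
    (hij : 0 < i + j) (hm : 0 < m) (hn : 0 < n) (hD : 0 < D) (hE : 0 < E)
    (hS : (c ^ m + e ^ n).IsHomogeneous D) (hT : (b ^ q + c ^ i * e ^ j).IsHomogeneous E) :
    HomRegular [b * c, b ^ q + c ^ i * e ^ j, c ^ m + e ^ n, a ^ p] := by
  refine mul ?_ ?_
  · have := H.swap.monomial_and_sum one_pos hp hij hm hn hD hS
    rw [pow_one] at this
    refine (this.congr hE hT ?_).third
    rw [add_sub_cancel_right]
    exact pow_mem_ofList (by simp) hq
  · have h₁ : HomRegular [b ^ q + c ^ i * e ^ j, a ^ p, c, e] := by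
      refine ((H.pow hp).swap.pow hq).congr hE hT ?_
      rw [add_sub_cancel_left]
      rcases i.eq_zero_or_pos with rfl | hi
      · exact Ideal.mul_mem_left _ _ (pow_mem_ofList (by simp) (by omega))
      · exact Ideal.mul_mem_right _ _ (pow_mem_ofList (by simp) hi)
    refine ((h₁.fourth.pow hn).congr hD hS ?_).swap.fourth
    rw [add_sub_cancel_right]
    exact pow_mem_ofList (by simp) hm

end HomRegular

section Esymm

theorem isHomogeneous_esymm [Fintype σ] (n : ℕ) : (esymm σ K n).IsHomogeneous n := by
  refine IsHomogeneous.sum _ _ _ fun s hs ↦ ?_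
  rw [← (Finset.mem_powersetCard.1 hs).2, Finset.card_eq_sum_ones]
  exact IsHomogeneous.prod _ _ _ fun i _ ↦ isHomogeneous_X _ _

variable {i j k l : Fin 4}

theorem univ_val_eq (h : [i, j, k, l].Nodup) :
    (Finset.univ : Finset (Fin 4)).val = {i, j, k, l} := by
  revert i j k l
  decide

theorem esymm_one_eq (h : [i, j, k, l].Nodup) :
    esymm (Fin 4) K 1 = X i + X j + X k + X l := by
  rw [esymm_eq_multiset_esymm, univ_val_eq h]
  simp [Multiset.esymm, Multiset.powersetCard_one]
  ring

theorem esymm_two_eq (h : [i, j, k, l].Nodup) :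
    esymm (Fin 4) K 2 = X i * (X j + X k + X l) + X j * (X k + X l) + X k * X l := by
  simp [esymm_eq_multiset_esymm, univ_val_eq h, Multiset.esymm, Multiset.powersetCard_one,
    Multiset.powersetCard_cons]
  ring

theorem esymm_three_eq (h : [i, j, k, l].Nodup) :
    esymm (Fin 4) K 3 = X i * (X j * X k + X j * X l + X k * X l) + X j * X k * X l := by
  simp [esymm_eq_multiset_esymm, univ_val_eq h, Multiset.esymm, Multiset.powersetCard_one,
    Multiset.powersetCard_cons]
  ring

theorem esymm_four_eq (h : [i, j, k, l].Nodup) :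
    esymm (Fin 4) K 4 = X i * X j * X k * X l := by
  simp [esymm_eq_multiset_esymm, univ_val_eq h, Multiset.esymm, Multiset.powersetCard_one,
    Multiset.powersetCard_cons]
  ring

theorem homRegular_esymm_one (h : [i, j, k, l].Nodup) :
    HomRegular [esymm (Fin 4) K 1, X i, X j, X k] := by
  have H := (HomRegular.map_X (K := K) h).fourth
  refine H.congr one_pos (isHomogeneous_esymm 1) ?_
  simp only [List.map, mem_ofList_cons, Ideal.ofList_nil, Ideal.mem_bot, esymm_one_eq h]
  exact ⟨1, 1, 1, by ring⟩

theorem homRegular_esymm_two (h : [i, j, k, l].Nodup) :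
    HomRegular [esymm (Fin 4) K 2, esymm (Fin 4) K 1, X i, X j] := by
  have hk := (homRegular_esymm_one (K := K) h).fourth
  have hl := (homRegular_esymm_one (K := K) (i := i) (j := j) (k := l) (l := k)
    (by grind)).fourth
  refine (hk.mul hl).congr two_pos (isHomogeneous_esymm 2) ?_
  simp only [mem_ofList_cons, Ideal.ofList_nil, Ideal.mem_bot, esymm_two_eq h]
  exact ⟨0, X j + X k + X l, X k + X l, by ring⟩

theorem homRegular_esymm_three (h : [i, j, k, l].Nodup) :
    HomRegular [esymm (Fin 4) K 3, esymm (Fin 4) K 2, esymm (Fin 4) K 1, X i] := by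
  have hj := (homRegular_esymm_two (K := K) h).fourth
  have hk := (homRegular_esymm_two (K := K) (i := i) (j := k) (k := l) (l := j)
    (by grind)).fourth
  have hl := (homRegular_esymm_two (K := K) (i := i) (j := l) (k := j) (l := k)
    (by grind)).fourth
  refine ((hj.mul hk).mul hl).congr three_pos (isHomogeneous_esymm 3) ?_
  simp only [mem_ofList_cons, Ideal.ofList_nil, Ideal.mem_bot, esymm_three_eq h]
  exact ⟨0, 0, X j * X k + X j * X l + X k * X l, by ring⟩

variable (K) in
theorem homRegular_esymm_four :
    HomRegular [esymm (Fin 4) K 4, esymm (Fin 4) K 3, esymm (Fin 4) K 2, esymm (Fin 4) K 1] := by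
  have h0 := (homRegular_esymm_three (K := K) (i := 0) (j := 1) (k := 2) (l := 3)
    (by decide)).fourth
  have h1 := (homRegular_esymm_three (K := K) (i := 1) (j := 0) (k := 2) (l := 3)
    (by decide)).fourth
  have h2 := (homRegular_esymm_three (K := K) (i := 2) (j := 0) (k := 1) (l := 3)
    (by decide)).fourth
  have h3 := (homRegular_esymm_three (K := K) (i := 3) (j := 0) (k := 1) (l := 2)
    (by decide)).fourth
  have := ((h0.mul h1).mul h2).mul h3
  rwa [← esymm_four_eq (by decide)] at this

end Esymm

end Regularity

section Height

theorem RevRegular.length_le_height {R : Type*} [CommRing R] {l : List R} (hl : RevRegular l)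
    {P : Ideal R} [P.IsPrime] (hP : Ideal.ofList l ≤ P) : (l.length : ℕ∞) ≤ P.height := by
  induction l generalizing P with
  | nil => simp
  | cons f l ih =>
    rw [Ideal.ofList_cons, sup_le_iff, Ideal.span_singleton_le_iff_mem] at hP
    obtain ⟨Q, hQ, hQP⟩ := Ideal.exists_minimalPrimes_le hP.2
    have : Q.IsPrime := hQ.isPrime
    have hfQ : f ∉ Q := fun hf ↦ by
      obtain ⟨g, hg, hfg⟩ := Ideal.exists_mul_mem_of_mem_minimalPrimes hQ hf
      exact hg (hl.2 g (by rwa [mul_comm]))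
    have hlt : Q < P := lt_of_le_of_ne hQP (by rintro rfl; exact hfQ hP.1)
    calc ((f :: l).length : ℕ∞) = l.length + 1 := by simp
      _ ≤ Q.height + 1 := by gcongr; exact ih hl.1 hQ.le
      _ ≤ P.height := Ideal.height_add_one_le_of_lt_of_isPrime hlt

theorem RevRegular.length_le_card {R : Type*} [CommRing R] [IsNoetherianRing R] {l : List R}
    (hl : RevRegular l) {T : Finset R} (hT : Ideal.span (T : Set R) ≠ ⊤)
    (h : ∀ f ∈ l, f ∈ Ideal.span (T : Set R)) : l.length ≤ T.card := by
  obtain ⟨P, hP⟩ := Ideal.nonempty_minimalPrimes hT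
  have : P.IsPrime := hP.isPrime
  have h₁ := hl.length_le_height (P := P) ((Ideal.span_le.2 h).trans hP.le)
  exact_mod_cast h₁.trans (Ideal.height_le_card_of_mem_minimalPrimes_span_finset hP)

end Height

section Necessity

theorem regSeq_iff (f : Fin 4 → MvPolynomial (Fin 4) ℂ) :
    RegSeq ((List.finRange 4).map f) ↔ RevRegular [f 3, f 2, f 1, f 0] := by
  have : (List.finRange 4).map f = [f 0, f 1, f 2, f 3] := rfl
  rw [this]
  have h₁ : Ideal.ofList [f 1, f 0] = Ideal.span {p | p ∈ [f 0, f 1]} :=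
    ofList_perm (by simp [List.perm_iff_count, List.count_cons, add_comm])
  have h₂ : Ideal.ofList [f 2, f 1, f 0] = Ideal.span {p | p ∈ [f 0, f 1, f 2]} :=
    ofList_perm (List.reverse_perm [f 0, f 1, f 2])
  simp only [RevRegular, h₁, h₂]
  constructor
  · intro h
    exact ⟨⟨⟨⟨trivial, h 0⟩, h 1⟩, h 2⟩, h 3⟩
  · rintro ⟨⟨⟨⟨-, h0⟩, h1⟩, h2⟩, h3⟩ i
    match i with
    | 0 => exact h0
    | 1 => exact h1
    | 2 => exact h2
    | 3 => exact h3

theorem exists_weight_eq {f : MvPolynomial (Fin 4) ℂ} {d : ℕ} (hd : f.IsHomogeneous d)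
    (hf : f.IsSymmetric) {S : Finset (Fin 4)}
    (h : f ∉ Ideal.span ((fun j : Fin 4 ↦ esymm (Fin 4) ℂ (j + 1)) '' {j | j ∉ S})) :
    ∃ m : Fin 4 → ℕ, (∀ j ∉ S, m j = 0) ∧ ∑ j : Fin 4, (j + 1) * m j = d := by
  by_contra! hm
  obtain ⟨g, hg⟩ := esymmAlgHom_surjective (σ := Fin 4) ℂ (n := 4) (by simp) ⟨f, hf⟩
  have hg : aeval (fun i : Fin 4 ↦ esymm (Fin 4) ℂ (i + 1)) g = f := by
    rw [← esymmAlgHom_apply, hg]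
  refine h ?_
  rw [← homogeneousComponent_eq_self hd, ← hg, aeval_def, eval₂_eq', map_sum]
  refine Ideal.sum_mem _ fun m _ ↦ ?_
  have hom : (∏ j : Fin 4, esymm (Fin 4) ℂ (j + 1) ^ m j).IsHomogeneous
      (∑ j : Fin 4, (j + 1) * m j) :=
    IsHomogeneous.prod _ _ _ fun j _ ↦ (isHomogeneous_esymm _).pow _
  rw [algebraMap_eq, homogeneousComponent_C_mul, homogeneousComponent_of_mem hom]
  split_ifs with hdm
  · obtain ⟨j, hjS, hj⟩ : ∃ j ∉ S, m j ≠ 0 := by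
      by_contra! hS
      exact hm m hS hdm.symm
    exact Ideal.mul_mem_left _ _ (Ideal.mem_of_dvd _ (Finset.dvd_prod_of_mem _ (Finset.mem_univ j))
      (Ideal.pow_mem_of_mem _ (Ideal.subset_span (Set.mem_image_of_mem _ hjS)) _
        (Nat.pos_of_ne_zero hj)))
  · simp

theorem IsRegularDegreeSequence.card_le {d : Fin 4 → ℕ} (hd : ∀ j, 0 < d j)
    (h : IsRegularDegreeSequence 4 d) (S : Finset (Fin 4)) (p : ℕ → Prop) [DecidablePred p]
    (hp : ∀ m : Fin 4 → ℕ, (∀ j ∉ S, m j = 0) → 0 < ∑ j : Fin 4, (j + 1) * m j →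
      p (∑ j : Fin 4, (j + 1) * m j)) :
    S.card ≤ (Finset.univ.filter fun j ↦ p (d j)).card := by
  classical
  obtain ⟨f, hf, hreg⟩ := h
  rw [regSeq_iff] at hreg
  set e : Fin 4 → MvPolynomial (Fin 4) ℂ := fun j ↦ esymm (Fin 4) ℂ (j + 1)
  set J := Finset.univ.filter fun j ↦ p (d j)
  have hT : Ideal.span ((Sᶜ.image e ∪ J.image f : Finset _) : Set (MvPolynomial (Fin 4) ℂ)) ≠
      ⊤ := by
    refine ne_top_of_le_ne_top (RingHom.ker_ne_top (constantCoeff (σ := Fin 4) (R := ℂ))) ?_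
    rw [Ideal.span_le]
    have key : ∀ {q : MvPolynomial (Fin 4) ℂ} {n : ℕ}, 0 < n → q.IsHomogeneous n →
        constantCoeff q = 0 := fun hn hq ↦ hq.coeff_eq_zero (by simpa using hn.ne)
    intro q hq
    simp only [Finset.coe_union, Finset.coe_image, Set.mem_union, Set.mem_image] at hq
    rcases hq with ⟨j, -, rfl⟩ | ⟨j, -, rfl⟩
    · exact key (Nat.succ_pos _) (isHomogeneous_esymm _)
    · exact key (hd j) (hf j).1
  have hmem : ∀ j, f j ∈ Ideal.span ((Sᶜ.image e ∪ J.image f : Finset _) : Set _) := by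
    intro j
    by_cases hj : p (d j)
    · exact Ideal.subset_span (by simp [J]; exact .inr ⟨j, hj, rfl⟩)
    · by_contra hfj
      obtain ⟨m, hmS, hm⟩ := exists_weight_eq (S := S) (hf j).1 (hf j).2 fun h ↦
        hfj (Ideal.span_mono (by
          rintro _ ⟨i, hi, rfl⟩
          simp only [Finset.coe_union, Finset.coe_image, Set.mem_union, Set.mem_image]
          exact .inl ⟨i, by simpa using hi, rfl⟩) h)
      exact hj (hm ▸ hp m hmS (hm ▸ hd j))
  have hcard := hreg.length_le_card hT fun q hq ↦ by
    simp only [List.mem_cons, List.not_mem_nil, or_false] at hq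
    rcases hq with rfl | rfl | rfl | rfl <;> exact hmem _
  have h₁ := (Finset.card_union_le (Sᶜ.image e) (J.image f)).trans
    (add_le_add Finset.card_image_le Finset.card_image_le)
  have h₂ := S.card_add_card_compl
  simp only [List.length_cons, List.length_nil, Fintype.card_fin] at hcard h₂
  omega

end Necessity

section Sufficiency

variable {d : Fin 4 → ℕ} {i j k l : Fin 4}

theorem perm_of_nodup : ∀ {i j k l : Fin 4}, [i, j, k, l].Nodup →
    [i, j, k, l].Perm [3, 2, 1, 0] := by
  decide

theorem isRegularDegreeSequence_of_homRegular (h : [i, j, k, l].Nodup)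
    {F₁ F₂ F₃ F₄ : MvPolynomial (Fin 4) ℂ} (H : HomRegular [F₁, F₂, F₃, F₄])
    (h₁ : F₁.IsHomogeneous (d i) ∧ F₁.IsSymmetric) (h₂ : F₂.IsHomogeneous (d j) ∧ F₂.IsSymmetric)
    (h₃ : F₃.IsHomogeneous (d k) ∧ F₃.IsSymmetric) (h₄ : F₄.IsHomogeneous (d l) ∧ F₄.IsSymmetric) :
    IsRegularDegreeSequence 4 d := by
  have hperm := perm_of_nodup h
  have hne : j ≠ i ∧ k ≠ i ∧ k ≠ j ∧ l ≠ i ∧ l ≠ j ∧ l ≠ k := by grind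
  obtain ⟨hji, hki, hkj, hli, hlj, hlk⟩ := hne
  let f : Fin 4 → MvPolynomial (Fin 4) ℂ := fun x ↦
    if x = i then F₁ else if x = j then F₂ else if x = k then F₃ else F₄
  have hfi : f i = F₁ := by simp [f]
  have hfj : f j = F₂ := by simp [f, hji]
  have hfk : f k = F₃ := by simp [f, hki, hkj]
  have hfl : f l = F₄ := by simp [f, hli, hlj, hlk]
  refine ⟨f, fun x ↦ ?_, (regSeq_iff f).2 ?_⟩
  · have hx : x = i ∨ x = j ∨ x = k ∨ x = l := by
      have : x ∈ [i, j, k, l] := hperm.mem_iff.2 (by revert x; decide)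
      simpa using this
    rcases hx with rfl | rfl | rfl | rfl
    · rwa [hfi]
    · rwa [hfj]
    · rwa [hfk]
    · rwa [hfl]
  · have := hperm.map f
    simp only [List.map, hfi, hfj, hfk, hfl] at this
    exact (H.perm this).2

theorem isHomogeneous_esymm_pow {r n D : ℕ} (h : r * n = D) :
    (esymm (Fin 4) ℂ r ^ n).IsHomogeneous D :=
  h ▸ (isHomogeneous_esymm r).pow n

theorem isHomogeneous_esymm_pow_mul_pow {r s m n D : ℕ} (h : r * m + s * n = D) :
    (esymm (Fin 4) ℂ r ^ m * esymm (Fin 4) ℂ s ^ n).IsHomogeneous D :=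
  h ▸ ((isHomogeneous_esymm r).pow m).mul ((isHomogeneous_esymm s).pow n)

theorem isSymmetric_esymm_pow (r n : ℕ) : (esymm (Fin 4) ℂ r ^ n).IsSymmetric :=
  pow_mem (S := symmetricSubalgebra (Fin 4) ℂ) (esymm_isSymmetric (Fin 4) ℂ r) n

theorem homRegular_esymm :
    HomRegular [esymm (Fin 4) ℂ 1, esymm (Fin 4) ℂ 2, esymm (Fin 4) ℂ 3, esymm (Fin 4) ℂ 4] :=
  (homRegular_esymm_four ℂ).perm (List.reverse_perm _).symm

theorem exists_eq_three_mul_add_four_mul {n : ℕ} (h0 : 0 < n) (h1 : n ≠ 1) (h2 : n ≠ 2)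
    (h5 : n ≠ 5) : ∃ α β, n = 3 * α + 4 * β ∧ 0 < α + β := by
  obtain h | h | h : n % 3 = 0 ∨ n % 3 = 1 ∨ n % 3 = 2 := by omega
  · exact ⟨n / 3, 0, by omega, by omega⟩
  · exact ⟨(n - 4) / 3, 1, by omega, by omega⟩
  · exact ⟨(n - 8) / 3, 2, by omega, by omega⟩

theorem isRegularDegreeSequence_of_twelve_dvd (hd : ∀ j, 0 < d j) (h : [i, j, k, l].Nodup)
    (hi1 : d i ≠ 1) (hi2 : d i ≠ 2) (hi5 : d i ≠ 5) (hj : 12 ∣ d j) (hl : 2 ∣ d l) :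
    IsRegularDegreeSequence 4 d := by
  obtain ⟨α, β, hαβ, hpos⟩ := exists_eq_three_mul_add_four_mul (hd i) hi1 hi2 hi5
  obtain ⟨κ, hκ⟩ := hj
  obtain ⟨q, hq⟩ := hl
  have := hd i
  have := hd j
  have := hd k
  have := hd l
  have hS : (esymm (Fin 4) ℂ 3 ^ (4 * κ) + esymm (Fin 4) ℂ 4 ^ (3 * κ)).IsHomogeneous (d j) :=
    (isHomogeneous_esymm_pow (by omega)).add (isHomogeneous_esymm_pow (by omega))
  exact isRegularDegreeSequence_of_homRegular h
    (homRegular_esymm.monomial_and_sum (p := d k) (q := q) (by omega) (by omega) hpos (by omega)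
      (by omega) (by omega) hS)
    ⟨isHomogeneous_esymm_pow_mul_pow hαβ.symm,
      (isSymmetric_esymm_pow _ _).mul (isSymmetric_esymm_pow _ _)⟩
    ⟨hS, (isSymmetric_esymm_pow _ _).add (isSymmetric_esymm_pow _ _)⟩
    ⟨isHomogeneous_esymm_pow (by omega), isSymmetric_esymm_pow _ _⟩
    ⟨isHomogeneous_esymm_pow (by omega), isSymmetric_esymm_pow _ _⟩

theorem isRegularDegreeSequence_of_five (hd : ∀ j, 0 < d j) (h : [i, j, k, l].Nodup)
    (hi : d i = 5) (hj : 2 ∣ d j) (hj2 : d j ≠ 2) (hk : 12 ∣ d k) :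
    IsRegularDegreeSequence 4 d := by
  obtain ⟨α, β, hαβ, hpos⟩ := exists_eq_three_mul_add_four_mul (hd j) (by omega) hj2 (by omega)
  obtain ⟨q, hq⟩ := hj
  obtain ⟨κ, hκ⟩ := hk
  have := hd i
  have := hd j
  have := hd k
  have := hd l
  have hS : (esymm (Fin 4) ℂ 3 ^ (4 * κ) + esymm (Fin 4) ℂ 4 ^ (3 * κ)).IsHomogeneous (d k) :=
    (isHomogeneous_esymm_pow (by omega)).add (isHomogeneous_esymm_pow (by omega))
  have hT : (esymm (Fin 4) ℂ 2 ^ q + esymm (Fin 4) ℂ 3 ^ α * esymm (Fin 4) ℂ 4 ^ β).IsHomogeneous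
      (d j) :=
    (isHomogeneous_esymm_pow (by omega)).add (isHomogeneous_esymm_pow_mul_pow (by omega))
  exact isRegularDegreeSequence_of_homRegular h
    (homRegular_esymm.product_and_two_sums (p := d l) (by omega) (by omega) hpos (by omega)
      (by omega) (by omega) (by omega) hS hT)
    ⟨hi ▸ (isHomogeneous_esymm 2).mul (isHomogeneous_esymm 3),
      (esymm_isSymmetric _ _ _).mul (esymm_isSymmetric _ _ _)⟩
    ⟨hT, (isSymmetric_esymm_pow _ _).add
      ((isSymmetric_esymm_pow _ _).mul (isSymmetric_esymm_pow _ _))⟩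
    ⟨hS, (isSymmetric_esymm_pow _ _).add (isSymmetric_esymm_pow _ _)⟩
    ⟨isHomogeneous_esymm_pow (by omega), isSymmetric_esymm_pow _ _⟩

theorem isRegularDegreeSequence_of_dvd (hd : ∀ j, 0 < d j) (h : [i, j, k, l].Nodup)
    (hj : 2 ∣ d j) (hk : 3 ∣ d k) (hl : 4 ∣ d l) : IsRegularDegreeSequence 4 d := by
  obtain ⟨q, hq⟩ := hj
  obtain ⟨m, hm⟩ := hk
  obtain ⟨n, hn⟩ := hl
  have := hd i
  have := hd j
  have := hd k
  have := hd l
  exact isRegularDegreeSequence_of_homRegular h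
    (homRegular_esymm.pows_of_pows (p := d i) (q := q) (m := m) (n := n) (by omega) (by omega)
      (by omega) (by omega))
    ⟨isHomogeneous_esymm_pow (by omega), isSymmetric_esymm_pow _ _⟩
    ⟨isHomogeneous_esymm_pow (by omega), isSymmetric_esymm_pow _ _⟩
    ⟨isHomogeneous_esymm_pow (by omega), isSymmetric_esymm_pow _ _⟩
    ⟨isHomogeneous_esymm_pow (by omega), isSymmetric_esymm_pow _ _⟩

theorem isRegularDegreeSequence_of_odd (hd : ∀ j, 0 < d j) (h : [i, j, k, l].Nodup)
    (hi : ¬ 2 ∣ d i) (hi1 : d i ≠ 1) (hj : 6 ∣ d j) (hl : 4 ∣ d l) :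
    IsRegularDegreeSequence 4 d := by
  obtain ⟨m, hm⟩ := hj
  obtain ⟨n, hn⟩ := hl
  have := hd i
  have := hd j
  have := hd k
  have := hd l
  have hS : (esymm (Fin 4) ℂ 2 ^ (3 * m) + esymm (Fin 4) ℂ 3 ^ (2 * m)).IsHomogeneous (d j) :=
    (isHomogeneous_esymm_pow (by omega)).add (isHomogeneous_esymm_pow (by omega))
  have H := homRegular_esymm.pows_of_pows (p := d k) (q := 1) (m := 1) (n := n) (by omega) one_pos
    one_pos (by omega)
  rw [pow_one, pow_one] at H
  have H' : HomRegular [esymm (Fin 4) ℂ 2, esymm (Fin 4) ℂ 3, esymm (Fin 4) ℂ 1 ^ d k,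
      esymm (Fin 4) ℂ 4 ^ n] := H.swap.perm (.cons _ (.swap ..))
  exact isRegularDegreeSequence_of_homRegular h
    (H'.pow_mul_pow_cons_add_pow (i := (d i - 3) / 2) (j := 1) (by omega) (by omega)
      (by omega) (hd j) hS)
    ⟨isHomogeneous_esymm_pow_mul_pow (by omega),
      (isSymmetric_esymm_pow _ _).mul (isSymmetric_esymm_pow _ _)⟩
    ⟨hS, (isSymmetric_esymm_pow _ _).add (isSymmetric_esymm_pow _ _)⟩
    ⟨isHomogeneous_esymm_pow (by omega), isSymmetric_esymm_pow _ _⟩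
    ⟨isHomogeneous_esymm_pow (by omega), isSymmetric_esymm_pow _ _⟩

end Sufficiency

section Permissible

variable {d : Fin 4 → ℕ}

theorem exists_nodup_of_ne : ∀ {i j : Fin 4}, i ≠ j → ∃ k l, [i, j, k, l].Nodup := by
  decide

theorem multiset_eq_of_nodup {i j k l : Fin 4} (h : [i, j, k, l].Nodup) :
    ({d 0, d 1, d 2, d 3} : Multiset ℕ) = {d i, d j, d k, d l} :=
  Multiset.coe_eq_coe.2
    ((List.reverse_perm [d 3, d 2, d 1, d 0]).trans ((perm_of_nodup h).symm.map d))

theorem countP_eq_card_filter (p : ℕ → Prop) [DecidablePred p] :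
    ({d 0, d 1, d 2, d 3} : Multiset ℕ).countP p = (Finset.univ.filter fun j ↦ p (d j)).card :=
  (Multiset.countP_map d Finset.univ.val p).trans rfl

theorem exists_ne_of_two_le_card {p : Fin 4 → Prop} [DecidablePred p]
    (h : 2 ≤ (Finset.univ.filter p).card) (i : Fin 4) : ∃ j ≠ i, p j := by
  obtain ⟨j, hj, hji⟩ := Finset.exists_mem_ne h i
  exact ⟨j, hji, by simpa using hj⟩

theorem exists_of_one_le_card {p : Fin 4 → Prop} [DecidablePred p]
    (h : 1 ≤ (Finset.univ.filter p).card) : ∃ j, p j := by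
  obtain ⟨j, hj⟩ := Finset.card_pos.1 h
  exact ⟨j, by simpa using hj⟩

theorem Permissible.two_le_card (h : Permissible 4 d) (hd : ∀ j, 0 < d j)
    (hne : ∀ δ : ℕ, 0 < δ →
      ({d 0, d 1, d 2, d 3} : Multiset ℕ) ≠ {1, 2, 5, 12 * δ} ∧
      ({d 0, d 1, d 2, d 3} : Multiset ℕ) ≠ {2, 2, 5, 12 * δ} ∧
      ({d 0, d 1, d 2, d 3} : Multiset ℕ) ≠ {5, 2, 5, 12 * δ}) (s : Fin 4) :
    ∃ t ≠ s, d t ≠ 1 ∧ d t ≠ 2 ∧ d t ≠ 5 := by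
  by_contra! H
  obtain ⟨r, hr⟩ := exists_of_one_le_card (h.1 3 (by simp) (by simp))
  obtain rfl : r = s := by
    by_contra hrs
    have := H r hrs
    omega
  obtain ⟨s, hs⟩ := exists_of_one_le_card (h.1 4 (by simp) (by simp))
  obtain rfl : s = r := by
    by_contra hrs
    have := H s hrs
    omega
  obtain ⟨p, hps, hp⟩ := exists_ne_of_two_le_card (h.1 2 (by simp) (by simp)) s
  obtain ⟨u, v, huv⟩ := exists_nodup_of_ne hps
  have hnd := huv
  simp only [List.nodup_cons, List.mem_cons, not_or, List.not_mem_nil] at hnd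
  have hp2 : d p = 2 := by have := H p hps; omega
  have hu : d u = 1 ∨ d u = 2 ∨ d u = 5 := by have := H u (Ne.symm hnd.2.1.1); omega
  have hv : d v = 1 ∨ d v = 2 ∨ d v = 5 := by have := H v (Ne.symm hnd.2.1.2.1); omega
  have hle : d u = 5 ∨ d v = 5 := by
    by_contra! hle
    have h₁ : ({p, u, v} : Finset (Fin 4)) ⊆ Finset.univ.filter fun j ↦ d j ≤ 2 := by
      intro x hx
      simp only [Finset.mem_insert, Finset.mem_singleton] at hx
      rw [Finset.mem_filter_univ]
      rcases hx with rfl | rfl | rfl <;> omega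
    have h₂ : ({p, u, v} : Finset (Fin 4)).card = 3 := Finset.card_eq_three.2
      ⟨p, u, v, hnd.1.2.1, hnd.1.2.2.1, hnd.2.2.1.1, rfl⟩
    have := (Finset.card_le_card h₁).trans (h.2 2 (by simp) (by simp))
    omega
  obtain ⟨δ, hδ⟩ : 12 ∣ d s := by omega
  obtain ⟨h₁, h₂, h₃⟩ := hne δ (by have := hd s; omega)
  rw [multiset_eq_of_nodup huv, hp2, hδ] at h₁ h₂ h₃
  have key : ∀ a b : ℕ, ({2, 12 * δ, a, b} : Multiset ℕ) = {a, 2, b, 12 * δ} := fun a b ↦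
    Multiset.coe_eq_coe.2 (by simp [List.perm_iff_count, List.count_cons]; omega)
  have key' : ∀ a b : ℕ, ({2, 12 * δ, a, b} : Multiset ℕ) = {b, 2, a, 12 * δ} := fun a b ↦
    Multiset.coe_eq_coe.2 (by simp [List.perm_iff_count, List.count_cons]; omega)
  rcases hle with hu5 | hv5
  · rw [hu5, key'] at h₁ h₂ h₃
    rcases hv with hv | hv | hv <;> rw [hv] at h₁ h₂ h₃ <;> contradiction
  · rw [hv5, key] at h₁ h₂ h₃
    rcases hu with hu | hu | hu <;> rw [hu] at h₁ h₂ h₃ <;> contradiction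

theorem isRegularDegreeSequence_of_forall_exists (hd : ∀ j, 0 < d j) (h : Permissible 4 d)
    (hns : ∀ s, ∃ t ≠ s, d t ≠ 1 ∧ d t ≠ 2 ∧ d t ≠ 5) : IsRegularDegreeSequence 4 d := by
  have hone : ∀ u v, u ≠ v → d u = 1 → d v ≠ 1 := fun u v huv hu hv ↦
    huv (Finset.card_le_one.1 (h.2 1 (by simp) (by simp)) u (by simp [hu]) v (by simp [hv]))
  obtain ⟨s, hs⟩ := exists_of_one_le_card (h.1 4 (by simp) (by simp))
  obtain ⟨r, hr⟩ := exists_of_one_le_card (h.1 3 (by simp) (by simp))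
  by_cases h12 : ∃ s, 12 ∣ d s
  · obtain ⟨s, hs⟩ := h12
    obtain ⟨p, hps, hp⟩ := exists_ne_of_two_le_card (h.1 2 (by simp) (by simp)) s
    have twelve : ∀ x y, x ≠ s → y ≠ s → x ≠ y → d x ≠ 1 ∧ d x ≠ 2 ∧ d x ≠ 5 → 2 ∣ d y →
        IsRegularDegreeSequence 4 d := by
      intro x y hxs hys hxy hx hy
      obtain ⟨k, hk⟩ : ∃ k, [x, s, k, y].Nodup := by
        clear * - hxs hys hxy
        revert x y s
        decide
      exact isRegularDegreeSequence_of_twelve_dvd hd hk hx.1 hx.2.1 hx.2.2 hs hy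
    obtain ⟨t, hts, ht⟩ := hns s
    by_cases htp : t = p
    · subst htp
      obtain ⟨u, v, huv⟩ := exists_nodup_of_ne hts
      have hnd := huv
      simp only [List.nodup_cons, List.mem_cons, not_or, List.not_mem_nil] at hnd
      obtain ⟨⟨-, htu, htv, -⟩, ⟨hsu, hsv, -⟩, ⟨huv', -⟩, -⟩ := hnd
      have odd_or : ∀ x, t ≠ x → s ≠ x →
          IsRegularDegreeSequence 4 d ∨ d x = 1 ∨ d x = 5 := by
        intro x htx hsx
        by_cases hx : 2 ∣ d x
        · exact .inl (twelve t x hts hsx.symm htx ht hx)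
        · by_cases hx' : d x ≠ 1 ∧ d x ≠ 2 ∧ d x ≠ 5
          · exact .inl (twelve x t hsx.symm hts htx.symm hx' hp)
          · exact .inr (by omega)
      have five : ∀ x y, [t, s, x, y].Nodup → d x = 5 → IsRegularDegreeSequence 4 d := by
        intro x y hxy hx
        refine isRegularDegreeSequence_of_five (i := x) (j := t) (k := s) (l := y) hd ?_ hx hp
          ht.2.1 hs
        clear * - hxy
        revert x y s t
        decide
      rcases odd_or u htu hsu with hu | hu | hu
      · exact hu
      · rcases odd_or v htv hsv with hv | hv | hv
        · exact hv
        · exact absurd hv (hone u v huv' hu)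
        · exact five v u ((List.Perm.swap ..).cons _ |>.cons _ |>.nodup_iff.1 huv) hv
      · exact five u v huv hu
    · exact twelve t p hts hps htp ht hp
  · push Not at h12
    have hrs : r ≠ s := by
      rintro rfl
      exact h12 r (by omega)
    obtain ⟨v, w, hvw⟩ := exists_nodup_of_ne hrs
    have hperm : [w, v, r, s].Nodup ∧ [v, w, r, s].Nodup ∧ [v, r, w, s].Nodup ∧
        [w, r, v, s].Nodup ∧ v ≠ w := by
      clear * - hvw
      revert r s v w
      decide
    obtain ⟨h₁, h₂, h₃, h₄, hne⟩ := hperm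
    by_cases hv : 2 ∣ d v
    · exact isRegularDegreeSequence_of_dvd hd h₁ hv hr hs
    by_cases hw : 2 ∣ d w
    · exact isRegularDegreeSequence_of_dvd hd h₂ hw hr hs
    obtain ⟨p, hps, hp⟩ := exists_ne_of_two_le_card (h.1 2 (by simp) (by simp)) s
    obtain rfl : p = r := by
      have : p ∈ [r, s, v, w] := by
        clear * - hvw
        revert r s v w p
        decide
      simp only [List.mem_cons, List.not_mem_nil, or_false] at this
      rcases this with rfl | rfl | rfl | rfl
      · rfl
      all_goals contradiction
    by_cases hv1 : d v = 1
    · exact isRegularDegreeSequence_of_odd hd h₄ hw (hone v w hne hv1) (by omega) hs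
    · exact isRegularDegreeSequence_of_odd hd h₃ hv hv1 (by omega) hs

theorem IsRegularDegreeSequence.two_le_card (hd : ∀ j, 0 < d j) (h : IsRegularDegreeSequence 4 d) :
    2 ≤ (Finset.univ.filter fun j ↦ d j ≠ 1 ∧ d j ≠ 2 ∧ d j ≠ 5).card :=
  h.card_le hd {2, 3} (fun n ↦ n ≠ 1 ∧ n ≠ 2 ∧ n ≠ 5) fun m hm h ↦ by
    have h0 := hm 0 (by decide)
    have h1 := hm 1 (by decide)
    simp only [Fin.sum_univ_four, h0, h1] at h ⊢
    simp at h ⊢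
    omega

theorem IsRegularDegreeSequence.permissible (hd : ∀ j, 0 < d j)
    (h : IsRegularDegreeSequence 4 d) : Permissible 4 d := by
  have h4 : 1 ≤ (Finset.univ.filter fun j ↦ 4 ∣ d j).card :=
    h.card_le hd {3} (4 ∣ ·) fun m hm _ ↦ by
      simp [Fin.sum_univ_four, hm 0 (by decide), hm 1 (by decide), hm 2 (by decide)]
  have h1 : 3 ≤ (Finset.univ.filter fun j ↦ d j ≠ 1).card :=
    h.card_le hd {1, 2, 3} (· ≠ 1) fun m hm _ ↦ by
      simp [Fin.sum_univ_four, hm 0 (by decide)]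
      omega
  have compl : ∀ (p q : Fin 4 → Prop) [DecidablePred p] [DecidablePred q],
      (∀ j, p j → ¬ q j) → (Finset.univ.filter p).card + (Finset.univ.filter q).card ≤ 4 := by
    intro p q _ _ hpq
    rw [← Finset.card_union_of_disjoint (Finset.disjoint_filter.2 fun j _ ↦ hpq j)]
    exact Finset.card_le_univ _
  refine ⟨fun i hi hi' ↦ ?_, fun i hi hi' ↦ ?_⟩ <;> interval_cases i
  · simp
  · exact h.card_le hd {1, 3} (2 ∣ ·) fun m hm _ ↦ by
      simp [Fin.sum_univ_four, hm 0 (by decide), hm 2 (by decide)]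
      omega
  · exact h.card_le hd {2} (3 ∣ ·) fun m hm _ ↦ by
      simp [Fin.sum_univ_four, hm 0 (by decide), hm 1 (by decide), hm 3 (by decide)]
  · exact h4
  · have := compl (fun j ↦ d j ≤ 1) (fun j ↦ d j ≠ 1) fun j _ ↦ by have := hd j; omega
    omega
  · have := compl (fun j ↦ d j ≤ 2) (fun j ↦ d j ≠ 1 ∧ d j ≠ 2 ∧ d j ≠ 5) fun j _ ↦ by
      have := hd j
      omega
    have := h.two_le_card hd
    omega
  · have := compl (fun j ↦ d j ≤ 3) (fun j ↦ 4 ∣ d j) fun j _ ↦ by have := hd j; omega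
    omega
  · exact Finset.card_le_univ _

end Permissible

theorem n_eq_four (d : Fin 4 → ℕ) (hd : ∀ j, 0 < d j) :
    IsRegularDegreeSequence 4 d ↔
      (Permissible 4 d ∧
        ∀ δ : ℕ, 0 < δ →
          ({d 0, d 1, d 2, d 3} : Multiset ℕ) ≠ {1, 2, 5, 12 * δ} ∧
          ({d 0, d 1, d 2, d 3} : Multiset ℕ) ≠ {2, 2, 5, 12 * δ} ∧
          ({d 0, d 1, d 2, d 3} : Multiset ℕ) ≠ {5, 2, 5, 12 * δ}) := by
  constructor
  · intro h
    refine ⟨h.permissible hd, fun δ hδ ↦ ?_⟩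
    have h₁ := h.two_le_card hd
    rw [← countP_eq_card_filter fun n ↦ n ≠ 1 ∧ n ≠ 2 ∧ n ≠ 5] at h₁
    have h₂ : ∀ a b c, a = 1 ∨ a = 2 ∨ a = 5 → b = 1 ∨ b = 2 ∨ b = 5 → c = 1 ∨ c = 2 ∨ c = 5 →
        ({d 0, d 1, d 2, d 3} : Multiset ℕ) ≠ {a, b, c, 12 * δ} := by
      intro a b c ha hb hc he
      rw [he] at h₁
      simp only [Multiset.insert_eq_cons] at h₁
      rw [Multiset.countP_cons_of_neg _ (by omega), Multiset.countP_cons_of_neg _ (by omega),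
        Multiset.countP_cons_of_neg _ (by omega)] at h₁
      have := h₁.trans (Multiset.countP_le_card _ _)
      simp at this
    exact ⟨h₂ _ _ _ (by simp) (by simp) (by simp), h₂ _ _ _ (by simp) (by simp) (by simp),
      h₂ _ _ _ (by simp) (by simp) (by simp)⟩
  · rintro ⟨h, hne⟩
    exact isRegularDegreeSequence_of_forall_exists hd h (h.two_le_card hd hne)
end

section
/- Let f_1,…,f_t, g ∈ ℂ[x_1,…,x_n] be homogeneous symmetric polynomials, and let Δ = ∏_{1≤i<j≤n} (x_j − x_i) be the Vandermonde determinant. Then the sequence f_1,…,f_t, g·Δ is a regular sequence if and only if both f_1,…,f_t, g and f_1,…,f_t, Δ are regular sequences. -/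
open MvPolynomial

/-- The Vandermonde determinant `∏_{i < j} (x_j - x_i)`. -/
noncomputable def vandermonde (n : ℕ) : MvPolynomial (Fin n) ℂ :=
  ∏ p ∈ Finset.univ.filter (fun p : Fin n × Fin n => p.1 < p.2), (X p.2 - X p.1)

theorem regSeq_append_singleton {n : ℕ} (fs : List (MvPolynomial (Fin n) ℂ))
    (a : MvPolynomial (Fin n) ℂ) :
    RegSeq (fs ++ [a]) ↔ RegSeq fs ∧
      ∀ h, h * a ∈ Ideal.span {p | p ∈ fs} → h ∈ Ideal.span {p | p ∈ fs} := by
  constructor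
  · refine fun H => ⟨fun i h hh => ?_, fun h hh => ?_⟩
    · have key := H ⟨i.1, by simp⟩ h
      simp only [List.get_eq_getElem, List.getElem_append_left i.2,
        List.take_append_of_le_length i.2.le] at key
      exact key hh
    · have key := H ⟨fs.length, by simp⟩ h
      simp only [List.get_eq_getElem, List.getElem_concat_length, List.take_left'] at key
      exact key hh
  · rintro ⟨H, Ha⟩ ⟨i, hi⟩ h hh
    rcases Nat.lt_or_ge i fs.length with hlt | hge
    · simp only [List.get_eq_getElem, List.getElem_append_left hlt,
        List.take_append_of_le_length hlt.le] at hh ⊢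
      exact H ⟨i, hlt⟩ h hh
    · obtain rfl : i = fs.length := by simp at hi; omega
      simp only [List.get_eq_getElem, List.getElem_concat_length, List.take_left'] at hh ⊢
      exact Ha h hh

theorem Ideal.forall_mul_mul_mem_imp_mem_iff {R : Type*} [CommRing R] (I : Ideal R) (a b : R) :
    (∀ h, h * (a * b) ∈ I → h ∈ I) ↔
      (∀ h, h * a ∈ I → h ∈ I) ∧ ∀ h, h * b ∈ I → h ∈ I := by
  refine ⟨fun H => ⟨fun h hh => H h ?_, fun h hh => H h ?_⟩, fun H h hh => ?_⟩
  · rw [← mul_assoc]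
    exact I.mul_mem_right b hh
  · rw [mul_left_comm]
    exact I.mul_mem_left a hh
  · rw [← mul_assoc] at hh
    exact H.1 h (H.2 _ hh)

theorem reg_seq_alt (n : ℕ) (fs : List (MvPolynomial (Fin n) ℂ))
    (g : MvPolynomial (Fin n) ℂ)
    (hfs : ∀ f ∈ fs, (∃ e : ℕ, f.IsHomogeneous e) ∧ f.IsSymmetric)
    (hg : (∃ e : ℕ, g.IsHomogeneous e) ∧ g.IsSymmetric) :
    RegSeq (fs ++ [g * vandermonde n]) ↔
      RegSeq (fs ++ [g]) ∧ RegSeq (fs ++ [vandermonde n]) := by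
  simp only [regSeq_append_singleton, Ideal.forall_mul_mul_mem_imp_mem_iff]
  exact and_and_left
end

section
/- Let n ≥ 2 and let d, a be positive integers. The triple (n,d,a) is bad if and only if there exists a point Q ∈ 𝒱_d such that 𝒫_λ(Q) = 0 for every partition λ of a. -/
open MvPolynomial

/-- The sequence `x_1^d - x_n^d, …, x_{n-1}^d - x_n^d` in `ℂ[x_1,…,x_n]`. -/
noncomputable def powDiffSeq (n d : ℕ) : List (MvPolynomial (Fin n) ℂ) :=
  (List.finRange (n - 1)).map fun i =>
    X (⟨i.1, by have := i.isLt; omega⟩ : Fin n) ^ d -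
    X (⟨n - 1, by have := i.isLt; omega⟩ : Fin n) ^ d

/-- The triple `(n,d,a)` is good if there is a homogeneous symmetric polynomial `f`
of degree `a` such that `x_1^d - x_n^d, …, x_{n-1}^d - x_n^d, f` is a regular
sequence. -/
def GoodTriple (n d a : ℕ) : Prop :=
  ∃ f : MvPolynomial (Fin n) ℂ, f.IsHomogeneous a ∧ f.IsSymmetric ∧
    RegSeq (powDiffSeq n d ++ [f])

/-- `𝒱_d`: the set of points `(z_1,…,z_n)` with `z_i^d = 1` for all `i` and `z_n = 1`. -/
def Vset (n d : ℕ) : Set (Fin n → ℂ) :=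
  {z | (∀ i, z i ^ d = 1) ∧ ∀ i : Fin n, (i : ℕ) = n - 1 → z i = 1}

/-- Substitute `x_i ↦ Q_i x_l` for `i ∈ S`, leaving the other variables unchanged. -/
noncomputable def substLine {n : ℕ} (l : Fin n) (S : Finset (Fin n)) (Q : Fin n → ℂ) :
    MvPolynomial (Fin n) ℂ →ₐ[ℂ] MvPolynomial (Fin n) ℂ :=
  aeval fun i => if i ∈ S then C (Q i) * X l else X i

lemma substLine_X {n : ℕ} (l : Fin n) (S : Finset (Fin n)) (Q : Fin n → ℂ) (i : Fin n) :
    substLine l S Q (X i) = if i ∈ S then C (Q i) * X l else X i := by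
  simp [substLine]

/-- The ideal generated by `x_i^d - x_l^d` for `i ∈ S`. -/
noncomputable def powDiffIdeal {n : ℕ} (d : ℕ) (l : Fin n) (S : Finset (Fin n)) :
    Ideal (MvPolynomial (Fin n) ℂ) :=
  Ideal.span ((fun j => X j ^ d - X l ^ d) '' (S : Set (Fin n)))

lemma substLine_eq_zero_of_mem {n d : ℕ} {l : Fin n} {S : Finset (Fin n)} (hl : l ∉ S)
    {Q : Fin n → ℂ} (hQ : ∀ i, Q i ^ d = 1) {p : MvPolynomial (Fin n) ℂ}
    (hp : p ∈ powDiffIdeal d l S) : substLine l S Q p = 0 := by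
  have : powDiffIdeal d l S ≤ RingHom.ker (substLine l S Q) := by
    refine Ideal.span_le.2 ?_
    rintro _ ⟨j, hj, rfl⟩
    have hj' : j ∈ S := hj
    simp [RingHom.mem_ker, substLine_X, hj', hl, mul_pow, ← C_pow, hQ]
  exact this hp

/-- The line substitutions by roots of unity jointly detect membership in `powDiffIdeal`. -/
lemma mem_powDiffIdeal_of_substLine {n d : ℕ} (hd : 0 < d) {l : Fin n} {S : Finset (Fin n)}
    (hl : l ∉ S) {p : MvPolynomial (Fin n) ℂ}
    (hp : ∀ Q : Fin n → ℂ, (∀ i, Q i ^ d = 1) → substLine l S Q p = 0) :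
    p ∈ powDiffIdeal d l S := by
  induction S using Finset.induction_on generalizing p with
  | empty =>
    have h := hp (fun _ => 1) (by simp)
    have : p = 0 := by simpa [substLine] using h
    simp [this]
  | insert k S hk ih =>
    have hlS : l ∉ S := fun h => hl (Finset.mem_insert_of_mem h)
    set M : Polynomial (MvPolynomial (Fin n) ℂ) := Polynomial.X ^ d - Polynomial.C (X l ^ d)
      with hM
    have hMm : M.Monic := Polynomial.monic_X_pow_sub_C _ hd.ne'
    have hMd : M.natDegree = d := Polynomial.natDegree_X_pow_sub_C
    set P : Polynomial (MvPolynomial (Fin n) ℂ) :=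
      aeval (fun i => if i = k then Polynomial.X else Polynomial.C (X i)) p with hP
    have hPe : P.eval (X k) = p := by
      have : ((Polynomial.aeval (X k : MvPolynomial (Fin n) ℂ)).restrictScalars ℂ).comp
          (aeval (R := ℂ) (fun i => if i = k then (Polynomial.X :
            Polynomial (MvPolynomial (Fin n) ℂ)) else Polynomial.C (X i))) =
          AlgHom.id ℂ (MvPolynomial (Fin n) ℂ) := by
        ext i
        by_cases h : i = k <;> simp [h]
      have := DFunLike.congr_fun this p
      simpa [hP, Polynomial.aeval_def, Polynomial.eval₂_eq_eval_map] using this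
    have hcoeff : ∀ j, (P %ₘ M).coeff j ∈ powDiffIdeal d l S := by
      intro j
      refine ih hlS fun Q hQ => ?_
      set φ := substLine l S Q with hφ
      have hzero : (P %ₘ M).map (φ : MvPolynomial (Fin n) ℂ →+* MvPolynomial (Fin n) ℂ) = 0 := by
        have hcard : (Polynomial.nthRootsFinset d (1 : ℂ)).card = d :=
          (Complex.isPrimitiveRoot_exp d hd.ne').card_nthRootsFinset
        have hinj : Function.Injective fun ζ : ℂ => (C ζ * X l : MvPolynomial (Fin n) ℂ) :=
          fun a b hab => C_injective _ _ (mul_right_cancel₀ (X_ne_zero l) hab)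
        refine Polynomial.eq_zero_of_natDegree_lt_card_of_eval_eq_zero' _
          ((Polynomial.nthRootsFinset d (1 : ℂ)).image
            fun ζ : ℂ => (C ζ * X l : MvPolynomial (Fin n) ℂ)) ?_ ?_
        · intro x hx
          obtain ⟨ζ, hζ, rfl⟩ := Finset.mem_image.1 hx
          have hζ' : ζ ^ d = 1 := (Polynomial.mem_nthRootsFinset hd 1).1 hζ
          have hQ' : ∀ i, Function.update Q k ζ i ^ d = 1 := by
            intro i
            by_cases h : i = k
            · subst h; simpa using hζ'
            · simpa [h] using hQ i
          have h0 := hp _ hQ'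
          have hcomp : ((Polynomial.eval₂RingHom
              (φ : MvPolynomial (Fin n) ℂ →+* MvPolynomial (Fin n) ℂ) (C ζ * X l)).comp
              (aeval (R := ℂ) (fun i => if i = k then (Polynomial.X :
                Polynomial (MvPolynomial (Fin n) ℂ)) else Polynomial.C (X i))).toRingHom) =
              (substLine l (insert k S) (Function.update Q k ζ)).toRingHom := by
            refine MvPolynomial.ringHom_ext ?_ ?_
            · intro r
              simp [MvPolynomial.algebraMap_eq, algHom_C]
            · intro i
              by_cases h : i = k
              · subst h
                simp [substLine_X]
              · simp [h, substLine_X, hφ]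
          have hPe' : P.eval₂ (φ : MvPolynomial (Fin n) ℂ →+* MvPolynomial (Fin n) ℂ)
              (C ζ * X l) = 0 := (DFunLike.congr_fun hcomp p).trans h0
          have hMe : M.eval₂ (φ : MvPolynomial (Fin n) ℂ →+* MvPolynomial (Fin n) ℂ)
              (C ζ * X l) = 0 := by
            rw [hM, Polynomial.eval₂_sub, Polynomial.eval₂_X_pow, Polynomial.eval₂_C]
            simp [hφ, substLine_X, hlS, mul_pow, ← C_pow, hζ']
          rw [Polynomial.eval_map]
          rw [← Polynomial.modByMonic_add_div P M, Polynomial.eval₂_add,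
            Polynomial.eval₂_mul, hMe, zero_mul, add_zero] at hPe'
          exact hPe'
        · rw [Finset.card_image_of_injective _ hinj, hcard]
          refine lt_of_le_of_lt Polynomial.natDegree_map_le ?_
          rw [← hMd]
          refine Polynomial.natDegree_modByMonic_lt _ hMm fun h => ?_
          rw [h, Polynomial.natDegree_one] at hMd
          exact hd.ne hMd
      have := congrArg (fun q => Polynomial.coeff q j) hzero
      simpa [Polynomial.coeff_map] using this
    have hle : powDiffIdeal d l S ≤ powDiffIdeal d l (insert k S) :=
      Ideal.span_mono (Set.image_mono (by simp))
    rw [← hPe, ← Polynomial.modByMonic_add_div P M, Polynomial.eval_add, Polynomial.eval_mul]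
    refine add_mem ?_ (Ideal.mul_mem_right _ _ ?_)
    · rw [Polynomial.eval_eq_sum_range]
      exact sum_mem fun j _ => Ideal.mul_mem_right _ _ (hle (hcoeff j))
    · refine Ideal.subset_span ⟨k, by simp, ?_⟩
      simp [hM]

lemma mem_powDiffIdeal_iff {n d : ℕ} (hd : 0 < d) {l : Fin n} {S : Finset (Fin n)}
    (hl : l ∉ S) {p : MvPolynomial (Fin n) ℂ} :
    p ∈ powDiffIdeal d l S ↔
      ∀ Q : Fin n → ℂ, (∀ i, Q i ^ d = 1) → substLine l S Q p = 0 :=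
  ⟨fun hp _ hQ => substLine_eq_zero_of_mem hl hQ hp, mem_powDiffIdeal_of_substLine hd hl⟩

lemma X_pow_sub_X_pow_ne_zero {n d : ℕ} (hd : 0 < d) {k l : Fin n} (hkl : k ≠ l) :
    (X k ^ d - X l ^ d : MvPolynomial (Fin n) ℂ) ≠ 0 := by
  intro h
  have := congrArg (eval fun i => if i = k then (1 : ℂ) else 0) h
  simp [hkl.symm, hd.ne'] at this

lemma aeval_C_mul_X_of_isHomogeneous {n a : ℕ} (l : Fin n) (q : Fin n → ℂ)
    {f : MvPolynomial (Fin n) ℂ} (hf : f.IsHomogeneous a) :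
    aeval (fun i => (C (q i) * X l : MvPolynomial (Fin n) ℂ)) f = C (eval q f) * X l ^ a := by
  rw [aeval_def, eval₂_eq, eval_eq, map_sum, Finset.sum_mul]
  refine Finset.sum_congr rfl fun s hs => ?_
  have hdeg : ∑ i ∈ s.support, s i = a := hf.degree_eq_sum_deg_support hs |>.symm
  simp [mul_pow, Finset.prod_mul_distrib, Finset.prod_pow_eq_pow_sum, hdeg, mul_assoc,
    MvPolynomial.algebraMap_eq]

/-- The index set `{0, …, i - 1}` inside `Fin n`. -/
def initialIndices (n i : ℕ) : Finset (Fin n) := Finset.univ.filter fun j => j.1 < i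

lemma span_take_eq_powDiffIdeal {n d : ℕ} (hn : 0 < n) (f : MvPolynomial (Fin n) ℂ) {i : ℕ}
    (hi : i ≤ n - 1) :
    Ideal.span {p | p ∈ (powDiffSeq n d ++ [f]).take i} =
      powDiffIdeal d ⟨n - 1, by omega⟩ (initialIndices n i) := by
  have hlen : (powDiffSeq n d).length = n - 1 := by simp [powDiffSeq]
  unfold powDiffIdeal
  congr 1
  ext p
  rw [List.take_append_of_le_length (by omega)]
  simp only [Set.mem_ofPred_eq, List.mem_take_iff_getElem, Set.mem_image, initialIndices,
    Finset.coe_filter, Finset.mem_univ, true_and]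
  constructor
  · rintro ⟨j, hj, rfl⟩
    exact ⟨⟨j, by omega⟩, by simp; omega, by simp [powDiffSeq]⟩
  · rintro ⟨j, hj, rfl⟩
    exact ⟨j, by omega, by simp [powDiffSeq]⟩

lemma regSeq_iff_forall_eval_ne_zero {n d a : ℕ} (hn : 0 < n) (hd : 0 < d)
    {f : MvPolynomial (Fin n) ℂ} (hf : f.IsHomogeneous a) :
    RegSeq (powDiffSeq n d ++ [f]) ↔ ∀ Q ∈ Vset n d, eval Q f ≠ 0 := by
  have hlen : (powDiffSeq n d).length = n - 1 := by simp [powDiffSeq]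
  set l : Fin n := ⟨n - 1, by omega⟩ with hl
  have hlS : ∀ i ≤ n - 1, l ∉ initialIndices n i := by
    intro i hi
    simp [initialIndices, hl, hi]
  have hmem : ∀ j : Fin n, j ≠ l → j ∈ initialIndices n (n - 1) := by
    intro j hj
    have : j.1 ≠ n - 1 := fun h => hj (Fin.ext h)
    simp only [initialIndices, Finset.mem_filter, Finset.mem_univ, true_and]
    omega
  have hsubst : ∀ Q ∈ Vset n d, substLine l (initialIndices n (n - 1)) Q f =
      C (eval Q f) * X l ^ a := by
    intro Q hQ
    rw [← aeval_C_mul_X_of_isHomogeneous l Q hf, substLine]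
    congr 2
    ext1 i
    by_cases h : i = l
    · subst h
      rw [if_neg (hlS _ le_rfl), hQ.2 l rfl]
      simp
    · rw [if_pos (hmem i h)]
  have hnorm : ∀ Q : Fin n → ℂ, (∀ i, Q i ^ d = 1) → Function.update Q l 1 ∈ Vset n d ∧
      substLine l (initialIndices n (n - 1)) Q =
        substLine l (initialIndices n (n - 1)) (Function.update Q l 1) := by
    intro Q hQ
    refine ⟨⟨fun i => ?_, fun i hi => ?_⟩, ?_⟩
    · by_cases h : i = l
      · subst h; simp
      · simpa [h] using hQ i
    · have : i = l := Fin.ext hi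
      subst this; simp
    · unfold substLine
      congr 1
      ext1 i
      by_cases h : i = l
      · subst h
        simp [hlS _ le_rfl]
      · simp [h]
  constructor
  · intro hreg Q hQ hfQ
    have hlast := hreg ⟨n - 1, by simp [hlen]⟩
    simp only [span_take_eq_powDiffIdeal hn f le_rfl] at hlast
    have hget : (powDiffSeq n d ++ [f]).get ⟨n - 1, by simp [hlen]⟩ = f := by
      simp [List.getElem_append_right, hlen]
    rw [hget] at hlast
    set g : MvPolynomial (Fin n) ℂ := ∏ j ∈ initialIndices n (n - 1),
      ∏ ζ ∈ (Polynomial.nthRootsFinset d (1 : ℂ)).erase (Q j), (X j - C ζ * X l) with hg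
    have hgf : g * f ∈ powDiffIdeal d l (initialIndices n (n - 1)) := by
      rw [mem_powDiffIdeal_iff hd (hlS _ le_rfl)]
      intro Q' hQ'
      rw [map_mul]
      by_cases heq : ∀ j ∈ initialIndices n (n - 1), Q' j = Q j
      · have : substLine l (initialIndices n (n - 1)) Q' =
            substLine l (initialIndices n (n - 1)) Q := by
          unfold substLine
          congr 1
          ext1 i
          by_cases h : i ∈ initialIndices n (n - 1)
          · simp [h, heq i h]
          · simp [h]
        rw [this, hsubst Q hQ, hfQ]
        simp
      · push Not at heq
        obtain ⟨j, hj, hne⟩ := heq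
        rw [hg, map_prod, Finset.prod_eq_zero hj, zero_mul]
        rw [map_prod]
        refine Finset.prod_eq_zero (i := Q' j)
          (Finset.mem_erase.2 ⟨hne, (Polynomial.mem_nthRootsFinset hd 1).2 (hQ' j)⟩) ?_
        simp [substLine_X, hj, hlS, algHom_C, MvPolynomial.algebraMap_eq]
    have h0 := substLine_eq_zero_of_mem (hlS _ le_rfl) hQ.1 (hlast g hgf)
    rw [hg, map_prod, Finset.prod_eq_zero_iff] at h0
    obtain ⟨j, hj, h0⟩ := h0
    rw [map_prod, Finset.prod_eq_zero_iff] at h0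
    obtain ⟨ζ, hζ, h0⟩ := h0
    have h1 : (C (Q j - ζ) * X l : MvPolynomial (Fin n) ℂ) = 0 := by
      simpa [substLine_X, hj, hlS, algHom_C, MvPolynomial.algebraMap_eq, sub_mul] using h0
    rcases mul_eq_zero.1 h1 with h | h
    · have : Q j - ζ = 0 := (map_eq_zero_iff C (C_injective _ _)).1 h
      exact (Finset.mem_erase.1 hζ).1 (sub_eq_zero.1 this).symm
    · exact X_ne_zero l h
  · rintro hne ⟨i, hi⟩ g hgi
    have hi' : i ≤ n - 1 := by simp [hlen] at hi; omega
    simp only [span_take_eq_powDiffIdeal hn f hi'] at hgi ⊢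
    rw [mem_powDiffIdeal_iff hd (hlS _ hi')] at hgi ⊢
    intro Q hQ
    have h0 := hgi Q hQ
    rw [map_mul] at h0
    refine (mul_eq_zero.1 h0).resolve_right ?_
    rcases hi'.lt_or_eq with hlt | rfl
    · have hget : (powDiffSeq n d ++ [f]).get ⟨i, hi⟩ =
          X (⟨i, by omega⟩ : Fin n) ^ d - X l ^ d := by
        simp [List.getElem_append_left, hlt, powDiffSeq, hl]
      have hil : (⟨i, by omega⟩ : Fin n) ≠ l := by
        intro h
        have := congrArg Fin.val h
        simp [hl] at this
        omega
      rw [hget]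
      have : (⟨i, by omega⟩ : Fin n) ∉ initialIndices n i := by simp [initialIndices]
      simpa [substLine_X, this, hlS i hi'] using X_pow_sub_X_pow_ne_zero hd hil
    · have hget : (powDiffSeq n d ++ [f]).get ⟨n - 1, hi⟩ = f := by
        simp [List.getElem_append_right, hlen]
      obtain ⟨hV, hs⟩ := hnorm Q hQ
      rw [hget, hs, hsubst _ hV]
      exact mul_ne_zero (by simpa using hne _ hV) (pow_ne_zero _ (X_ne_zero l))

lemma esymm_mem_adjoin_psum (σ : Type*) [Fintype σ] (k : ℕ) :
    esymm σ ℂ k ∈ Algebra.adjoin ℂ (psum σ ℂ '' {b | 0 < b}) := by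
  induction k using Nat.strong_induction_on with
  | _ k ih =>
    rcases Nat.eq_zero_or_pos k with rfl | hk
    · simp
    · have h := mul_esymm_eq_sum σ ℂ k
      have hmem : (k : MvPolynomial σ ℂ) * esymm σ ℂ k ∈
          Algebra.adjoin ℂ (psum σ ℂ '' {b | 0 < b}) := by
        rw [h]
        refine mul_mem (pow_mem (neg_mem (one_mem _)) _) (sum_mem fun x hx => ?_)
        obtain ⟨hx, hlt⟩ := Finset.mem_filter.1 hx
        have hx := Finset.HasAntidiagonal.mem_antidiagonal.1 hx
        refine mul_mem (mul_mem (pow_mem (neg_mem (one_mem _)) _) (ih _ hlt)) ?_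
        exact Algebra.subset_adjoin ⟨x.2, by simp; omega, rfl⟩
      have := Subalgebra.smul_mem _ hmem ((k : ℂ)⁻¹)
      have hk' : (k : ℂ) ≠ 0 := by exact_mod_cast hk.ne'
      convert this using 1
      rw [← map_natCast (C (σ := σ) (R := ℂ)), ← smul_eq_C_mul, smul_smul, inv_mul_cancel₀ hk',
        one_smul]

lemma mem_adjoin_psum_of_isSymmetric {σ : Type*} [Fintype σ] {f : MvPolynomial σ ℂ}
    (hf : f.IsSymmetric) : f ∈ Algebra.adjoin ℂ (psum σ ℂ '' {b | 0 < b}) := by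
  obtain ⟨p, hp⟩ := esymmAlgHom_surjective ℂ (n := Fintype.card σ) (σ := σ) le_rfl ⟨f, hf⟩
  replace hp := congrArg Subtype.val hp
  rw [esymmAlgHom_apply] at hp
  replace hp : aeval (fun i : Fin (Fintype.card σ) => esymm σ ℂ (i + 1)) p = f := hp
  rw [← hp]
  clear hp
  generalize hA : Algebra.adjoin ℂ (psum σ ℂ '' {b | 0 < b}) = A
  have hmem : ∀ k, esymm σ ℂ k ∈ A := fun k => hA ▸ esymm_mem_adjoin_psum σ k
  clear hA
  induction p using MvPolynomial.induction_on with
  | C r => simpa using A.algebraMap_mem r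
  | add p q hp hq => simpa using add_mem hp hq
  | mul_X p i hp => simpa using mul_mem hp (hmem _)

lemma isHomogeneous_psum (σ R : Type*) [Fintype σ] [CommSemiring R] (b : ℕ) :
    (psum σ R b).IsHomogeneous b :=
  IsHomogeneous.sum _ _ _ fun i _ => isHomogeneous_X_pow i b

lemma isHomogeneous_prod_map_psum (σ R : Type*) [Fintype σ] [CommSemiring R] (m : Multiset ℕ) :
    (m.map (psum σ R)).prod.IsHomogeneous m.sum := by
  induction m using Multiset.induction_on with
  | empty => simpa using isHomogeneous_one σ R
  | cons b m ih => simpa using (isHomogeneous_psum σ R b).mul ih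

lemma isSymmetric_prod_map_psum (σ R : Type*) [Fintype σ] [CommSemiring R] (m : Multiset ℕ) :
    (m.map (psum σ R)).prod.IsSymmetric := by
  induction m using Multiset.induction_on with
  | empty => simp
  | cons b m ih => simpa using (psum_isSymmetric σ R b).mul ih

lemma eval_prod_map_psum {σ : Type*} [Fintype σ] (Q : σ → ℂ) (m : Multiset ℕ) :
    eval Q (m.map (psum σ ℂ)).prod = (m.map fun b => ∑ i, Q i ^ b).prod := by
  rw [map_multiset_prod, Multiset.map_map]
  simp [psum, Function.comp_def]

/-- A homogeneous symmetric polynomial vanishes wherever all products of power sums of the same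
degree vanish. -/
lemma eval_eq_zero_of_forall_partition {σ : Type*} [Fintype σ] {a : ℕ} {Q : σ → ℂ}
    (hQ : ∀ μ : Nat.Partition a, (μ.parts.map fun b => ∑ i, Q i ^ b).prod = 0)
    {f : MvPolynomial σ ℂ} (hs : f.IsSymmetric) (hf : f.IsHomogeneous a) : eval Q f = 0 := by
  have hmem : f ∈ Submodule.span ℂ
      (Submonoid.closure (psum σ ℂ '' {b | 0 < b}) : Set (MvPolynomial σ ℂ)) := by
    rw [← Algebra.adjoin_eq_span]
    exact mem_adjoin_psum_of_isSymmetric hs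
  have key : ∀ g ∈ Submodule.span ℂ
      (Submonoid.closure (psum σ ℂ '' {b | 0 < b}) : Set (MvPolynomial σ ℂ)),
      eval Q (homogeneousComponent a g) = 0 := by
    intro g hg
    induction hg using Submodule.span_induction with
    | zero => simp
    | add x y _ _ hx hy => simp [hx, hy]
    | smul r x _ hx => simp [smul_eval, hx]
    | mem x hx =>
      obtain ⟨m, hm, rfl⟩ : ∃ m : Multiset ℕ, (∀ b ∈ m, 0 < b) ∧
          (m.map (psum σ ℂ)).prod = x := by
        induction hx using Submonoid.closure_induction with
        | mem x hx =>
          obtain ⟨b, hb, rfl⟩ := hx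
          exact ⟨{b}, by simpa using hb, by simp⟩
        | one => exact ⟨0, by simp, by simp⟩
        | mul x y _ _ hx hy =>
          obtain ⟨m, hm, rfl⟩ := hx
          obtain ⟨m', hm', rfl⟩ := hy
          refine ⟨m + m', fun b hb => ?_, by simp⟩
          exact (Multiset.mem_add.1 hb).elim (hm b) (hm' b)
      rw [homogeneousComponent_of_mem (isHomogeneous_prod_map_psum σ ℂ m)]
      split_ifs with h
      · rw [eval_prod_map_psum]
        exact hQ ⟨m, fun {i} hi => hm i hi, h.symm⟩
      · simp
  have := key f hmem
  rwa [homogeneousComponent_of_mem hf, if_pos rfl] at this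

lemma finite_Vset (n : ℕ) {d : ℕ} (hd : 0 < d) : (Vset n d).Finite := by
  refine (Set.Finite.pi' (t := fun _ : Fin n => (Polynomial.nthRootsFinset d (1 : ℂ) : Set ℂ))
    fun _ => Finset.finite_toSet _).subset fun z hz i => ?_
  exact (Polynomial.mem_nthRootsFinset hd 1).2 (hz.1 i)

theorem power_sums_suffice (n d a : ℕ) (hn : 2 ≤ n) (hd : 0 < d) (ha : 0 < a) :
    ¬ GoodTriple n d a ↔
      ∃ Q ∈ Vset n d, ∀ μ : Nat.Partition a,
        (μ.parts.map fun b => ∑ i, Q i ^ b).prod = 0 := by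
  constructor
  · intro hbad
    by_contra! hex
    apply hbad
    have := (finite_Vset n hd).to_subtype
    let p : Submodule ℂ (MvPolynomial (Fin n) ℂ) :=
      homogeneousSubmodule (Fin n) ℂ a ⊓
        Subalgebra.toSubmodule (symmetricSubalgebra (Fin n) ℂ)
    obtain ⟨f, hfp, hf⟩ := Module.Dual.exists_forall_mem_ne_zero_of_forall_exists p
      (fun Q : Vset n d => (aeval (R := ℂ) Q.1).toLinearMap) (by
        rintro ⟨Q, hQ⟩
        obtain ⟨μ, hμ⟩ := hex Q hQ
        refine ⟨(μ.parts.map (psum (Fin n) ℂ)).prod, ⟨?_, ?_⟩, ?_⟩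
        · simpa [μ.parts_sum] using isHomogeneous_prod_map_psum (Fin n) ℂ μ.parts
        · exact isSymmetric_prod_map_psum (Fin n) ℂ μ.parts
        · rw [← eval_prod_map_psum] at hμ
          simpa [aeval_eq_eval] using hμ)
    refine ⟨f, hfp.1, hfp.2, (regSeq_iff_forall_eval_ne_zero (by omega) hd hfp.1).2 ?_⟩
    intro Q hQ
    simpa [aeval_eq_eval] using hf ⟨Q, hQ⟩
  · rintro ⟨Q, hQ, hzero⟩ ⟨f, hhom, hsymm, hreg⟩
    exact (regSeq_iff_forall_eval_ne_zero (by omega) hd hhom).1 hreg Q hQ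
      (eval_eq_zero_of_forall_partition hzero hsymm hhom)
end

section
/- Let n, a, d be positive integers and let g = gcd(a,d). Then there exist d-th roots of unity z_1,…,z_n (not necessarily distinct) such that z_1^a + z_2^a + ⋯ + z_n^a = 0 if and only if n ∈ Γ(d/g). -/
/-- `Γ(m)`: the numerical semigroup generated by the prime divisors of `m`. -/
def Gamma (m : ℕ) : AddSubmonoid ℕ :=
  AddSubmonoid.closure {p : ℕ | p.Prime ∧ p ∣ m}

open IntermediateField in
theorem finrank_adjoin_primitiveRoot {m : ℕ} (hm : 0 < m) {η : ℂ} (hη : IsPrimitiveRoot η m) :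
    Module.finrank ℚ ℚ⟮η⟯ = m.totient := by
  rw [adjoin.finrank (hη.isIntegral hm).tower_top, ← Polynomial.cyclotomic_eq_minpoly_rat hη hm,
    Polynomial.natDegree_cyclotomic]

open IntermediateField in
theorem le_natDegree_minpoly_adjoin {m k D : ℕ} (hm : 0 < m) (hk : 0 < k) {η ζ ξ : ℂ}
    (hη : IsPrimitiveRoot η m) (hξ : IsPrimitiveRoot ξ k) (hζ : IsIntegral ℚ ζ)
    (hmem : ξ ∈ ℚ⟮η⟯⟮ζ⟯) (hD : k.totient = m.totient * D) :
    D ≤ (minpoly ℚ⟮η⟯ ζ).natDegree := by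
  have hηint : IsIntegral ℚ η := (hη.isIntegral hm).tower_top
  have hζint : IsIntegral ℚ⟮η⟯ ζ := hζ.tower_top
  have : FiniteDimensional ℚ ℚ⟮η⟯ := adjoin.finiteDimensional hηint
  have : FiniteDimensional ℚ⟮η⟯ ℚ⟮η⟯⟮ζ⟯ := adjoin.finiteDimensional hζint
  have : FiniteDimensional ℚ (restrictScalars ℚ ℚ⟮η⟯⟮ζ⟯) :=
    FiniteDimensional.trans ℚ ℚ⟮η⟯ ℚ⟮η⟯⟮ζ⟯
  have hle : ℚ⟮ξ⟯ ≤ restrictScalars ℚ ℚ⟮η⟯⟮ζ⟯ := by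
    rw [adjoin_simple_le_iff]
    exact hmem
  have hrank := finrank_le_of_le_right hle
  have htower : Module.finrank ℚ ℚ⟮η⟯ * Module.finrank ℚ⟮η⟯ ℚ⟮η⟯⟮ζ⟯ =
      Module.finrank ℚ (restrictScalars ℚ ℚ⟮η⟯⟮ζ⟯) :=
    Module.finrank_mul_finrank ℚ ℚ⟮η⟯ ℚ⟮η⟯⟮ζ⟯
  rw [← htower, finrank_adjoin_primitiveRoot hk hξ, finrank_adjoin_primitiveRoot hm hη, hD,
    adjoin.finrank hζint] at hrank
  exact Nat.le_of_mul_le_mul_left hrank (Nat.totient_pos.2 hm)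

theorem eq_zero_of_sum_mul_pow_eq_zero {K : IntermediateField ℚ ℂ} {ζ : ℂ} {D : ℕ}
    (hD : D ≤ (minpoly K ζ).natDegree) {c : ℕ → ℂ} (hc : ∀ i, c i ∈ K)
    (h : ∑ i ∈ Finset.range D, c i * ζ ^ i = 0) : ∀ i < D, c i = 0 := by
  have hli : LinearIndependent K fun i : Fin D => ζ ^ (i : ℕ) :=
    (linearIndependent_pow (K := K) ζ).comp (Fin.castLE hD) (Fin.castLE_injective hD)
  rw [Fintype.linearIndependent_iff] at hli
  intro i hi
  have := hli (fun j => ⟨c j, hc j⟩) (by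
    rw [Finset.sum_range] at h
    simpa [Algebra.smul_def] using h) ⟨i, hi⟩
  exact congrArg Subtype.val this

open IntermediateField in
/-- Adjoining an `(r * m)`-th root of unity to the `m`-th cyclotomic field, with `r ∣ m`. -/
theorem eq_zero_of_sum_mul_primitiveRoot_pow {m r : ℕ} (hm : 0 < m) (hr : r.Prime) (hrm : r ∣ m)
    {η ζ : ℂ} (hη : IsPrimitiveRoot η m) (hζ : IsPrimitiveRoot ζ (r * m)) {c : ℕ → ℂ}
    (hc : ∀ i, c i ∈ ℚ⟮η⟯) (h : ∑ i ∈ Finset.range r, c i * ζ ^ i = 0) : ∀ i < r, c i = 0 := by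
  have hpos : 0 < r * m := Nat.mul_pos hr.pos hm
  refine eq_zero_of_sum_mul_pow_eq_zero (le_natDegree_minpoly_adjoin hm hpos hη hζ
    (hζ.isIntegral hpos).tower_top (mem_adjoin_simple_self _ _) ?_) hc h
  rw [Nat.totient_mul_of_prime_of_dvd hr hrm, mul_comm]

open IntermediateField in
/-- Adjoining an `r`-th root of unity to the `m`-th cyclotomic field, with `r ∤ m`. -/
theorem eq_of_sum_mul_primitiveRoot_pow {m r : ℕ} (hm : 0 < m) (hr : r.Prime) (hrm : ¬ r ∣ m)
    {η ζ : ℂ} (hη : IsPrimitiveRoot η m) (hζ : IsPrimitiveRoot ζ r) {c : ℕ → ℂ}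
    (hc : ∀ i, c i ∈ ℚ⟮η⟯) (h : ∑ i ∈ Finset.range r, c i * ζ ^ i = 0) :
    ∀ i < r, c i = c (r - 1) := by
  have hcop : (orderOf η).Coprime (orderOf ζ) := by
    rw [← hη.eq_orderOf, ← hζ.eq_orderOf]
    exact ((Nat.Prime.coprime_iff_not_dvd hr).2 hrm).symm
  have hξ : IsPrimitiveRoot (η * ζ) (m * r) := by
    rw [IsPrimitiveRoot.iff_orderOf,
      (Commute.all η ζ).orderOf_mul_eq_mul_orderOf_of_coprime hcop, ← hη.eq_orderOf,
      ← hζ.eq_orderOf]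
  have hmem : η * ζ ∈ ℚ⟮η⟯⟮ζ⟯ :=
    mul_mem (IntermediateField.algebraMap_mem ℚ⟮η⟯⟮ζ⟯ ⟨η, mem_adjoin_simple_self ℚ η⟩)
      (mem_adjoin_simple_self _ _)
  have hdeg : r - 1 ≤ (minpoly ℚ⟮η⟯ ζ).natDegree :=
    le_natDegree_minpoly_adjoin hm (Nat.mul_pos hm hr.pos) hη hξ
      (hζ.isIntegral hr.pos).tower_top hmem (by
        rw [mul_comm m r, Nat.totient_mul_of_prime_of_not_dvd hr hrm, mul_comm])
  have hsum : ∑ i ∈ Finset.range (r - 1), (c i - c (r - 1)) * ζ ^ i = 0 := by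
    have hgeom := hζ.geom_sum_eq_zero hr.one_lt
    obtain ⟨s, rfl⟩ : ∃ s, r = s + 1 := ⟨r - 1, by have := hr.pos; omega⟩
    rw [Finset.sum_range_succ] at h hgeom
    simp only [Nat.add_sub_cancel, sub_mul, Finset.sum_sub_distrib, ← Finset.mul_sum]
    linear_combination h - c s * hgeom
  intro i hi
  rcases (Nat.le_sub_one_of_lt hi).lt_or_eq with h1 | h1
  · exact sub_eq_zero.1 (eq_zero_of_sum_mul_pow_eq_zero hdeg
      (fun j => sub_mem (hc j) (hc (r - 1))) hsum i h1)
  · rw [h1]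

open IntermediateField in
theorem multiset_sum_mem_adjoin_primitiveRoot {m : ℕ} (hm : 0 < m) {η : ℂ}
    (hη : IsPrimitiveRoot η m) {s : Multiset ℂ} (hs : ∀ z ∈ s, z ^ m = 1) : s.sum ∈ ℚ⟮η⟯ := by
  have : NeZero m := ⟨hm.ne'⟩
  refine multiset_sum_mem _ fun z hz => ?_
  obtain ⟨i, -, rfl⟩ := hη.eq_pow_of_pow_eq_one (hs z hz)
  exact pow_mem (mem_adjoin_simple_self ℚ η) i

/-- Splitting a multiset of roots of unity along the cosets of the `m`-th roots of unity. -/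
theorem exists_coset_decomposition {m k r : ℕ} {ζ : ℂ}
    (hcos : ∀ z : ℂ, z ^ k = 1 → ∃ i < r, ∃ w : ℂ, w ^ m = 1 ∧ z = w * ζ ^ i)
    (x : Multiset ℂ) (hx : ∀ z ∈ x, z ^ k = 1) :
    ∃ X : ℕ → Multiset ℂ, (∀ i, ∀ z ∈ X i, z ^ m = 1) ∧
      x.card = ∑ i ∈ Finset.range r, (X i).card ∧
      x.sum = ∑ i ∈ Finset.range r, (X i).sum * ζ ^ i := by
  induction x using Multiset.induction_on with
  | empty => exact ⟨fun _ => 0, by simp⟩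
  | cons a s ih =>
    obtain ⟨X, h1, h2, h3⟩ := ih fun z hz => hx z (Multiset.mem_cons_of_mem hz)
    obtain ⟨i, hi, w, hw, rfl⟩ := hcos a (hx a (Multiset.mem_cons_self a s))
    have hi' := Finset.mem_range.2 hi
    refine ⟨fun j => X j + if j = i then {w} else 0, fun j z hz => ?_, ?_, ?_⟩
    · rcases Multiset.mem_add.1 hz with h | h
      · exact h1 j z h
      · split_ifs at h with hj
        · rwa [Multiset.mem_singleton.1 h]
        · simp at h
    · simp [Finset.sum_add_distrib, h2, apply_ite Multiset.card, hi]
    · simp [Finset.sum_add_distrib, h3, apply_ite Multiset.sum, add_mul, ite_mul, hi, add_comm]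

theorem exists_coset_of_dvd {m r : ℕ} (hm : 0 < m) (hr : r.Prime) {ζ : ℂ}
    (hζ : IsPrimitiveRoot ζ (r * m)) (z : ℂ) (hz : z ^ (r * m) = 1) :
    ∃ i < r, ∃ w : ℂ, w ^ m = 1 ∧ z = w * ζ ^ i := by
  have : NeZero (r * m) := ⟨(Nat.mul_pos hr.pos hm).ne'⟩
  obtain ⟨l, -, rfl⟩ := hζ.eq_pow_of_pow_eq_one hz
  refine ⟨l % r, Nat.mod_lt _ hr.pos, ζ ^ (r * (l / r)), ?_, ?_⟩
  · rw [← pow_mul, show r * (l / r) * m = r * m * (l / r) by ring, pow_mul, hζ.pow_eq_one, one_pow]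
  · rw [← pow_add, Nat.div_add_mod]

theorem exists_coset_of_not_dvd {m r : ℕ} (hr : r.Prime) (hrm : ¬ r ∣ m) {ζ : ℂ}
    (hζ : IsPrimitiveRoot ζ r) (z : ℂ) (hz : z ^ (r * m) = 1) :
    ∃ i < r, ∃ w : ℂ, w ^ m = 1 ∧ z = w * ζ ^ i := by
  have : NeZero r := ⟨hr.ne_zero⟩
  have hcop : m.Coprime (orderOf ζ) := by
    rw [← hζ.eq_orderOf]
    exact ((Nat.Prime.coprime_iff_not_dvd hr).2 hrm).symm
  obtain ⟨i, -, hi⟩ := hζ.eq_pow_of_pow_eq_one (ξ := z ^ m) (by rw [← pow_mul, mul_comm, hz])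
  obtain ⟨u, hu⟩ := exists_pow_eq_self_of_coprime hcop
  have hζ0 : ζ ≠ 0 := hζ.ne_zero hr.ne_zero
  refine ⟨(u * i) % r, Nat.mod_lt _ hr.pos, z / ζ ^ ((u * i) % r), ?_,
    (div_mul_cancel₀ _ (pow_ne_zero _ hζ0)).symm⟩
  have hmod : ζ ^ ((u * i) % r) = ζ ^ (u * i) := by
    conv_rhs => rw [← Nat.mod_add_div (u * i) r, pow_add, pow_mul, hζ.pow_eq_one, one_pow, mul_one]
  rw [hmod, div_pow, ← hi, ← pow_mul, show u * i * m = m * u * i by ring, pow_mul, pow_mul, hu,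
    div_self (pow_ne_zero _ hζ0)]

theorem Gamma_mono {m k : ℕ} (h : m ∣ k) : Gamma m ≤ Gamma k :=
  AddSubmonoid.closure_mono fun _ hp => ⟨hp.1, hp.2.trans h⟩

theorem mem_Gamma_of_prime_dvd {m p : ℕ} (hp : p.Prime) (h : p ∣ m) : p ∈ Gamma m :=
  AddSubmonoid.subset_closure ⟨hp, h⟩

/-- If two multisets of `m`-th roots of unity have the same sum and are short in terms of the
bounds `p` and `q`, then their cardinalities differ by an element of `Γ(m)`. -/
def ShortSumsDifferByGamma (m p q : ℕ) : Prop :=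
  ∀ x y : Multiset ℂ, (∀ z ∈ x, z ^ m = 1) → (∀ z ∈ y, z ^ m = 1) → x.sum = y.sum →
    y.card < (p - x.card) * (q - 1) → ∃ g ∈ Gamma m, y.card = x.card + g

theorem sum_eq_card_of_pow_one_eq_one {x : Multiset ℂ} (hx : ∀ z ∈ x, z ^ 1 = 1) :
    x.sum = x.card := by
  conv_lhs => rw [Multiset.eq_replicate_card.2 fun z hz => (pow_one z).symm.trans (hx z hz)]
  simp

theorem card_eq_of_sum_eq_of_pow_one_eq_one {x y : Multiset ℂ} (hx : ∀ z ∈ x, z ^ 1 = 1)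
    (hy : ∀ z ∈ y, z ^ 1 = 1) (h : x.sum = y.sum) : x.card = y.card := by
  rw [sum_eq_card_of_pow_one_eq_one hx, sum_eq_card_of_pow_one_eq_one hy] at h
  exact_mod_cast h

theorem shortSumsDifferByGamma_one (p q : ℕ) : ShortSumsDifferByGamma 1 p q :=
  fun _ _ hx hy h _ => ⟨0, zero_mem _, (card_eq_of_sum_eq_of_pow_one_eq_one hx hy h).symm⟩

theorem ShortSumsDifferByGamma.mul_of_dvd {m p q r : ℕ} (ih : ShortSumsDifferByGamma m p q)
    (hm : 0 < m) (hr : r.Prime) (hrm : r ∣ m) : ShortSumsDifferByGamma (r * m) p q := by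
  intro x y hx hy hxy hlt
  obtain ⟨η, hη⟩ : ∃ η : ℂ, IsPrimitiveRoot η m := ⟨_, Complex.isPrimitiveRoot_exp m hm.ne'⟩
  obtain ⟨ζ, hζ⟩ : ∃ ζ : ℂ, IsPrimitiveRoot ζ (r * m) :=
    ⟨_, Complex.isPrimitiveRoot_exp _ (Nat.mul_pos hr.pos hm).ne'⟩
  obtain ⟨X, hX, hXcard, hXsum⟩ := exists_coset_decomposition (exists_coset_of_dvd hm hr hζ) x hx
  obtain ⟨Y, hY, hYcard, hYsum⟩ := exists_coset_decomposition (exists_coset_of_dvd hm hr hζ) y hy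
  have hzero := eq_zero_of_sum_mul_primitiveRoot_pow hm hr hrm hη hζ
    (c := fun i => (Y i).sum - (X i).sum)
    (fun i => sub_mem (multiset_sum_mem_adjoin_primitiveRoot hm hη (hY i))
      (multiset_sum_mem_adjoin_primitiveRoot hm hη (hX i)))
    (by simp only [sub_mul, Finset.sum_sub_distrib, ← hXsum, ← hYsum, hxy, sub_self])
  have key : ∀ i, ∃ g ∈ Gamma m, i < r → (Y i).card = (X i).card + g := by
    intro i
    by_cases hi : i < r
    · have hXi : (X i).card ≤ x.card := hXcard ▸ Finset.single_le_sum
        (f := fun i => (X i).card) (fun _ _ => Nat.zero_le _) (Finset.mem_range.2 hi)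
      have hYi : (Y i).card ≤ y.card := hYcard ▸ Finset.single_le_sum
        (f := fun i => (Y i).card) (fun _ _ => Nat.zero_le _) (Finset.mem_range.2 hi)
      obtain ⟨g, hg, h⟩ := ih (X i) (Y i) (hX i) (hY i) (sub_eq_zero.1 (hzero i hi)).symm
        (hYi.trans_lt (hlt.trans_le (Nat.mul_le_mul_right _ (Nat.sub_le_sub_left hXi p))))
      exact ⟨g, hg, fun _ => h⟩
    · exact ⟨0, zero_mem _, fun h => absurd h hi⟩
  choose g hg hcard using key
  refine ⟨∑ i ∈ Finset.range r, g i,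
    sum_mem fun i _ => Gamma_mono (Dvd.intro_left r rfl) (hg i), ?_⟩
  rw [hYcard, hXcard, ← Finset.sum_add_distrib]
  exact Finset.sum_congr rfl fun i hi => hcard i (Finset.mem_range.1 hi)

theorem lt_mul_of_average_bounds {p q r a b c N Y : ℕ} (hp : p ≤ r) (hq : q ≤ r) (hca : c ≤ a)
    (hN : N < (p - a) * (q - 1)) (havg : r * b ≤ N + a * b)
    (hY : (r - 1) * b + Y ≤ N + (a - c) * b) : Y < (p - (c + b)) * (q - 1) := by
  have hpa : 0 < p - a := Nat.pos_of_mul_pos_right (Nat.zero_lt_of_lt hN)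
  have hq1 : 0 < q - 1 := Nat.pos_of_mul_pos_left (Nat.zero_lt_of_lt hN)
  obtain ⟨s, rfl⟩ : ∃ s, p = a + s := ⟨p - a, by omega⟩
  obtain ⟨t, rfl⟩ : ∃ t, q = t + 1 := ⟨q - 1, by omega⟩
  obtain ⟨f, rfl⟩ : ∃ f, a = c + f := ⟨a - c, by omega⟩
  obtain ⟨u, rfl⟩ : ∃ u, r = u + 1 := ⟨r - 1, by omega⟩
  simp only [Nat.add_sub_cancel, Nat.add_sub_cancel_left] at *
  have htu : t ≤ u := by omega
  have hbt : b < t := by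
    by_contra! hb
    have h1 : (c + f + s) * b ≤ (u + 1) * b := Nat.mul_le_mul_right b hp
    have h2 : s * t ≤ s * b := Nat.mul_le_mul_left s hb
    nlinarith
  by_contra! hcon
  have hsub : (f + s : ℤ) - b ≤ ((c + f + s - (c + b) : ℕ) : ℤ) := by omega
  zify at hcon hN hY htu hbt
  have h1 := mul_le_mul_of_nonneg_right hsub (Int.natCast_nonneg t)
  have h2 := mul_le_mul_of_nonneg_right htu (Int.natCast_nonneg b)
  have h3 := mul_le_mul_of_nonneg_left hbt.le (Int.natCast_nonneg f)
  nlinarith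

/-- The average bounds satisfied by the minimum `b` of `Y` over the zero set of `X`. -/
theorem mul_le_sum_add_sum_mul {s : Finset ℕ} {X Y : ℕ → ℕ} {b : ℕ}
    (hmin : ∀ i ∈ s, X i = 0 → b ≤ Y i) :
    s.card * b ≤ ∑ i ∈ s, Y i + (∑ i ∈ s, X i) * b := by
  rw [Finset.sum_mul, ← Finset.sum_add_distrib, ← smul_eq_mul]
  refine Finset.card_nsmul_le_sum _ _ _ fun i hi => ?_
  rcases Nat.eq_zero_or_pos (X i) with h | h
  · exact (hmin i hi h).trans (Nat.le_add_right _ _)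
  · exact (Nat.le_mul_of_pos_left b h).trans (Nat.le_add_left _ _)

theorem ShortSumsDifferByGamma.mul_of_not_dvd {m p q r : ℕ}
    (ih : ShortSumsDifferByGamma m p q) (hm : 0 < m) (hr : r.Prime) (hrm : ¬ r ∣ m)
    (hpr : p ≤ r) (hqr : q ≤ r ∨ m = 1) : ShortSumsDifferByGamma (r * m) p q := by
  intro x y hx hy hxy hlt
  obtain ⟨η, hη⟩ : ∃ η : ℂ, IsPrimitiveRoot η m := ⟨_, Complex.isPrimitiveRoot_exp m hm.ne'⟩
  obtain ⟨ζ, hζ⟩ : ∃ ζ : ℂ, IsPrimitiveRoot ζ r := ⟨_, Complex.isPrimitiveRoot_exp r hr.ne_zero⟩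
  obtain ⟨X, hX, hXcard, hXsum⟩ :=
    exists_coset_decomposition (exists_coset_of_not_dvd hr hrm hζ) x hx
  obtain ⟨Y, hY, hYcard, hYsum⟩ :=
    exists_coset_decomposition (exists_coset_of_not_dvd hr hrm hζ) y hy
  have hconst := eq_of_sum_mul_primitiveRoot_pow hm hr hrm hη hζ
    (c := fun i => (Y i).sum - (X i).sum)
    (fun i => sub_mem (multiset_sum_mem_adjoin_primitiveRoot hm hη (hY i))
      (multiset_sum_mem_adjoin_primitiveRoot hm hη (hX i)))
    (by simp only [sub_mul, Finset.sum_sub_distrib, ← hXsum, ← hYsum, hxy, sub_self])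
  have hxr : x.card < r := by
    have := Nat.pos_of_mul_pos_right (Nat.zero_lt_of_lt hlt)
    omega
  have hne : ((Finset.range r).filter fun i => (X i).card = 0).Nonempty := by
    by_contra hempty
    rw [Finset.not_nonempty_iff_eq_empty, Finset.filter_eq_empty_iff] at hempty
    have := Finset.card_nsmul_le_sum (Finset.range r) (fun i => (X i).card) 1
      fun i hi => Nat.pos_of_ne_zero (hempty hi)
    rw [← hXcard, Finset.card_range, smul_eq_mul, mul_one] at this
    omega
  obtain ⟨k, hk, hkmin⟩ := Finset.exists_min_image _ (fun i => (Y i).card) hne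
  rw [Finset.mem_filter, Finset.mem_range] at hk
  set b := (Y k).card
  have hmin : ∀ i ∈ Finset.range r, (X i).card = 0 → b ≤ (Y i).card :=
    fun i hi h => hkmin i (Finset.mem_filter.2 ⟨hi, h⟩)
  have havg := mul_le_sum_add_sum_mul hmin
  rw [← hXcard, ← hYcard, Finset.card_range] at havg
  have key : ∀ j, ∃ g ∈ Gamma m, j < r → (Y j).card = (X j).card + b + g := by
    intro j
    by_cases hj : j < r
    swap
    · exact ⟨0, zero_mem _, fun h => absurd h hj⟩
    have hroots : ∀ z ∈ X j + Y k, z ^ m = 1 := fun z hz =>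
      (Multiset.mem_add.1 hz).elim (hX j z) (hY k z)
    have hsum : (X j + Y k).sum = (Y j).sum := by
      have h := (hconst j hj).trans (hconst k hk.1).symm
      simp only [Multiset.card_eq_zero.1 hk.2, Multiset.sum_zero, sub_zero] at h
      rw [Multiset.sum_add, ← h, add_sub_cancel]
    rcases hqr with hqr | rfl
    · have hj' := Finset.mem_range.2 hj
      have hXj := Finset.add_sum_erase _ (fun i => (X i).card) hj'
      have hYj := Finset.add_sum_erase _ (fun i => (Y i).card) hj'
      rw [← hXcard] at hXj
      rw [← hYcard] at hYj
      have hrest := mul_le_sum_add_sum_mul (s := (Finset.range r).erase j) (b := b)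
        fun i hi => hmin i (Finset.mem_of_mem_erase hi)
      rw [Finset.card_erase_of_mem hj', Finset.card_range] at hrest
      obtain ⟨g, hg, h⟩ := ih (X j + Y k) (Y j) hroots (hY j) hsum (by
        rw [Multiset.card_add]
        refine lt_mul_of_average_bounds (b := b) hpr hqr (by omega) hlt havg ?_
        rw [show x.card - (X j).card = ∑ i ∈ (Finset.range r).erase j, (X i).card by omega]
        omega)
      exact ⟨g, hg, fun _ => by rw [h, Multiset.card_add]⟩
    · refine ⟨0, zero_mem _, fun _ => ?_⟩
      rw [← card_eq_of_sum_eq_of_pow_one_eq_one hroots (hY j) hsum, Multiset.card_add, add_zero]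
  choose g hg hcard using key
  refine ⟨b • r + ∑ i ∈ Finset.range r, g i, add_mem
    (nsmul_mem (mem_Gamma_of_prime_dvd hr (Dvd.intro m rfl)) b)
    (sum_mem fun i _ => Gamma_mono (Dvd.intro_left r rfl) (hg i)), ?_⟩
  rw [hYcard, hXcard, Finset.sum_congr rfl fun i hi => hcard i (Finset.mem_range.1 hi)]
  simp [Finset.sum_add_distrib, mul_comm, add_assoc]

theorem shortSumsDifferByGamma {m p q : ℕ} (hm : 0 < m) (hpq : p ≤ q)
    (h : ∀ r : ℕ, r.Prime → r ∣ m → r = p ∨ q ≤ r) : ShortSumsDifferByGamma m p q := by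
  induction m using Nat.strong_induction_on with
  | _ m ih =>
  rcases eq_or_ne m 1 with rfl | hm1
  · exact shortSumsDifferByGamma_one p q
  have step : ∀ r : ℕ, r.Prime → ∀ l, m = r * l → 0 < l ∧ ShortSumsDifferByGamma l p q := by
    rintro r hr l rfl
    have hl : 0 < l := Nat.pos_of_mul_pos_left hm
    exact ⟨hl, ih l ((Nat.lt_mul_iff_one_lt_left hl).2 hr.one_lt) hl
      fun s hs hsl => h s hs (hsl.mul_left r)⟩
  by_cases hlarge : ∃ r : ℕ, r.Prime ∧ r ∣ m ∧ q ≤ r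
  · obtain ⟨r, hr, ⟨l, rfl⟩, hqr⟩ := hlarge
    obtain ⟨hl, hS⟩ := step r hr l rfl
    by_cases hrl : r ∣ l
    · exact hS.mul_of_dvd hl hr hrl
    · exact hS.mul_of_not_dvd hl hr hrl (hpq.trans hqr) (Or.inl hqr)
  · have hall : ∀ r : ℕ, r.Prime → r ∣ m → r = p := fun r hr hrm =>
      (h r hr hrm).resolve_right fun hqr => hlarge ⟨r, hr, hrm, hqr⟩
    obtain ⟨r, hr, l, rfl⟩ := Nat.exists_prime_and_dvd hm1
    obtain rfl := hall r hr (Dvd.intro l rfl)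
    obtain ⟨hl, hS⟩ := step r hr l rfl
    by_cases hrl : r ∣ l
    · exact hS.mul_of_dvd hl hr hrl
    · refine hS.mul_of_not_dvd hl hr hrl le_rfl (Or.inr ?_)
      by_contra hl1
      obtain ⟨s, hs, hsl⟩ := Nat.exists_prime_and_dvd hl1
      exact hrl (hall s hs (hsl.mul_left r) ▸ hsl)

theorem mem_Gamma_of_le {m p q n : ℕ} (hp : p.Prime) (hpm : p ∣ m) (hq : q.Prime) (hqm : q ∣ m)
    (hpq : p ≠ q) (hn : p * (q - 1) ≤ n) : n ∈ Gamma m := by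
  have hfrob := (frobeniusNumber_iff.1 (frobeniusNumber_pair
    ((Nat.coprime_primes hp hq).2 hpq) hp.one_lt hq.one_lt)).2 n
  refine AddSubmonoid.closure_mono ?_ (hfrob ?_)
  · rintro r (rfl | rfl)
    exacts [⟨hp, hpm⟩, ⟨hq, hqm⟩]
  · have h1 := hp.pos
    have h2 := hq.pos
    have h3 : 0 < p * (q - 1) := Nat.mul_pos h1 (by have := hq.one_lt; omega)
    rw [Nat.mul_sub_one] at hn h3
    omega

/-- The **Lam–Leung theorem** on the lengths of vanishing sums of roots of unity. -/
theorem card_mem_Gamma_of_sum_eq_zero {m : ℕ} (hm : 0 < m) {y : Multiset ℂ}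
    (hy : ∀ z ∈ y, z ^ m = 1) (h : y.sum = 0) : y.card ∈ Gamma m := by
  have aux : ∀ p q : ℕ, p ≤ q → (∀ r : ℕ, r.Prime → r ∣ m → r = p ∨ q ≤ r) →
      y.card < p * (q - 1) → y.card ∈ Gamma m := by
    intro p q hpq hprimes hlt
    obtain ⟨g, hg, hcard⟩ := shortSumsDifferByGamma hm hpq hprimes 0 y (by simp) hy
      (by simpa using h.symm) (by simpa using hlt)
    rwa [hcard, Multiset.card_zero, zero_add]
  rcases eq_or_ne m 1 with rfl | hm1
  · exact aux 1 (y.card + 2) (by omega)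
      (fun r hr h1 => absurd (Nat.dvd_one.1 h1) hr.ne_one) (by omega)
  have hp := Nat.minFac_prime hm1
  by_cases hother : ∃ q : ℕ, q.Prime ∧ q ∣ m ∧ q ≠ m.minFac
  · classical
    obtain ⟨hq, hqm, hqp⟩ := Nat.find_spec hother
    rcases lt_or_ge y.card (m.minFac * (Nat.find hother - 1)) with hlt | hge
    · exact aux _ _ (Nat.minFac_le_of_dvd hq.two_le hqm)
        (fun r hr hrm => or_iff_not_imp_left.2 fun hne => Nat.find_min' hother ⟨hr, hrm, hne⟩) hlt
    · exact mem_Gamma_of_le hp (Nat.minFac_dvd m) hq hqm hqp.symm hge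
  · push Not at hother
    refine aux m.minFac (m.minFac + y.card + 1) (by omega)
      (fun r hr hrm => Or.inl (hother r hr hrm)) ?_
    have := Nat.mul_le_mul_right (m.minFac + y.card) hp.one_lt.le
    have := hp.pos
    rw [Nat.add_sub_cancel]
    omega

theorem exists_sum_eq_zero_of_mem_Gamma {m n : ℕ} (h : n ∈ Gamma m) :
    ∃ y : Multiset ℂ, (∀ z ∈ y, z ^ m = 1) ∧ y.card = n ∧ y.sum = 0 := by
  induction h using AddSubmonoid.closure_induction with
  | mem p hp =>
    obtain ⟨hp, k, rfl⟩ := hp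
    have hζ := Complex.isPrimitiveRoot_exp p hp.ne_zero
    refine ⟨(Multiset.range p).map fun i => Complex.exp (2 * Real.pi * Complex.I / p) ^ i,
      fun z hz => ?_, by simp, hζ.geom_sum_eq_zero hp.one_lt⟩
    obtain ⟨i, -, rfl⟩ := Multiset.mem_map.1 hz
    rw [← pow_mul, show i * (p * k) = p * (i * k) by ring, pow_mul, hζ.pow_eq_one, one_pow]
  | zero => exact ⟨0, by simp⟩
  | add a b _ _ iha ihb =>
    obtain ⟨y, hy, rfl, hys⟩ := iha
    obtain ⟨w, hw, rfl, hws⟩ := ihb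
    exact ⟨y + w, fun z hz => (Multiset.mem_add.1 hz).elim (hy z) (hw z), by simp,
      by simp [hys, hws]⟩

theorem exists_root_pow_eq {a d : ℕ} (ha : 0 < a) {w : ℂ} (hw : w ^ (d / Nat.gcd a d) = 1) :
    ∃ z : ℂ, z ^ d = 1 ∧ z ^ a = w := by
  have hg : 0 < Nat.gcd a d := Nat.gcd_pos_of_pos_left d ha
  have hcop : (a / Nat.gcd a d).Coprime (orderOf w) :=
    (Nat.coprime_div_gcd_div_gcd hg).coprime_dvd_right (orderOf_dvd_of_pow_eq_one hw)
  obtain ⟨u, hu⟩ := exists_pow_eq_self_of_coprime hcop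
  obtain ⟨z, hz⟩ := IsAlgClosed.exists_pow_nat_eq (w ^ u) hg
  refine ⟨z, ?_, ?_⟩
  · rw [← Nat.mul_div_cancel' (Nat.gcd_dvd_right a d), pow_mul, hz, ← pow_mul, mul_comm, pow_mul,
      hw, one_pow]
  · conv_lhs => rw [← Nat.mul_div_cancel' (Nat.gcd_dvd_left a d), pow_mul, hz, ← pow_mul, mul_comm,
      pow_mul, hu]

theorem LL_cor (n a d : ℕ) (hn : 0 < n) (ha : 0 < a) (hd : 0 < d) :
    (∃ z : Fin n → ℂ, (∀ i, z i ^ d = 1) ∧ ∑ i, z i ^ a = 0) ↔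
      n ∈ Gamma (d / Nat.gcd a d) := by
  constructor
  · rintro ⟨z, hz, hsum⟩
    have hpos : 0 < d / Nat.gcd a d :=
      Nat.div_pos (Nat.le_of_dvd hd (Nat.gcd_dvd_right a d)) (Nat.gcd_pos_of_pos_left d ha)
    have hroots : ∀ w ∈ Finset.univ.val.map fun i => z i ^ a, w ^ (d / Nat.gcd a d) = 1 := by
      intro w hw
      obtain ⟨i, -, rfl⟩ := Multiset.mem_map.1 hw
      rw [← pow_mul, ← Nat.mul_div_assoc a (Nat.gcd_dvd_right a d), mul_comm,
        Nat.mul_div_assoc d (Nat.gcd_dvd_left a d), pow_mul, hz, one_pow]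
    simpa using card_mem_Gamma_of_sum_eq_zero hpos hroots hsum
  · intro h
    obtain ⟨y, hy, hcard, hsum⟩ := exists_sum_eq_zero_of_mem_Gamma h
    obtain ⟨l, rfl⟩ : ∃ l : List ℂ, (l : Multiset ℂ) = y := ⟨y.toList, y.coe_toList⟩
    obtain rfl : l.length = n := hcard
    choose z hzd hza using fun i : Fin l.length => exists_root_pow_eq ha (hy l[i] (by simp))
    refine ⟨z, hzd, ?_⟩
    rw [Finset.sum_congr rfl fun i _ => hza i]
    simpa using hsum
end
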